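/- arXiv:1310.0208 — 4 statements merged into one kernel-verified Lean document; each statement's English description precedes it below -/
import Mathlib

section
/- Let Γ be a non-elementary discrete purely hyperbolic subgroup of SL(2,ℝ) and let Φ and Θ be nontrivial subgroups of Γ. Then every point of ℝP¹ that is both a conical limit point of Φ and a uniform conical limit point of Θ is a conical limit point of Φ ∩ Θ; that is, Λ_c(Φ) ∩ Λ_c^u(Θ) ⊆ Λ_c(Φ ∩ Θ). -/
open scoped MatrixGroups LinearAlgebra.Projectivization UpperHalfPlane Pointwise
open Matrix

noncomputable section

/-- The topology on `SL(2, ℝ)` as a subspace of the space of `2 × 2` real matrices. -/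
instance : TopologicalSpace SL(2, ℝ) :=
  inferInstanceAs (TopologicalSpace { A : Matrix (Fin 2) (Fin 2) ℝ // A.det = 1 })

/-- The real projective line. -/
abbrev RP1 : Type := ℙ ℝ (Fin 2 → ℝ)

instance : TopologicalSpace RP1 :=
  inferInstanceAs (TopologicalSpace (Quotient (projectivizationSetoid ℝ (Fin 2 → ℝ))))

/-- The action of `SL(2, ℝ)` on the real projective line, via its linear action on `ℝ²`. -/
def sl2Act (g : SL(2, ℝ)) (p : RP1) : RP1 :=
  Projectivization.map (Matrix.SpecialLinearGroup.toLin' g).toLinearMap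
    (Matrix.SpecialLinearGroup.toLin' g).injective p

/-- The point `[x : 1]` of the real projective line. -/
def projPt (x : ℝ) : RP1 :=
  Projectivization.mk ℝ ![x, 1] (by
    intro h
    have := congrFun h 1
    simp at this)

/-- The point `∞ = [1 : 0]` of the real projective line. -/
def projInf : RP1 :=
  Projectivization.mk ℝ ![1, 0] (by
    intro h
    have := congrFun h 0
    simp at this)

/-- The ray in the upper half-plane associated to a point of `ℝP¹`:
`ray [x:1] = {x + i t : 0 < t ≤ 1}` and `ray ∞ = {i t : t ≥ 1}`. -/
def ray (p : RP1) : Set ℍ :=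
  if p.rep 1 = 0 then {z : ℍ | z.re = 0 ∧ 1 ≤ z.im}
  else {z : ℍ | z.re = p.rep 0 / p.rep 1 ∧ z.im ≤ 1}

/-- An element of `SL(2, ℝ)` is hyperbolic if the absolute value of its trace exceeds `2`. -/
def IsHyperbolic (g : SL(2, ℝ)) : Prop :=
  2 < |Matrix.trace (g : Matrix (Fin 2) (Fin 2) ℝ)|

/-- A subgroup of `SL(2, ℝ)` is purely hyperbolic if all of its non-identity elements
are hyperbolic. -/
def PurelyHyperbolic (Γ : Subgroup SL(2, ℝ)) : Prop :=
  ∀ g ∈ Γ, g ≠ 1 → IsHyperbolic g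

/-- A subgroup of `SL(2, ℝ)` is non-elementary if it is not virtually abelian, i.e. it has
no abelian subgroup of finite index. -/
def IsNonElementary (Γ : Subgroup SL(2, ℝ)) : Prop :=
  ¬ ∃ H : Subgroup Γ, H.FiniteIndex ∧ ∀ a ∈ H, ∀ b ∈ H, a * b = b * a

/-- `p ∈ ℝP¹` is a conical limit point of `Γ'` if some compact subset of `ℍ` has infinitely
many `Γ'`-translates meeting the ray ending at `p`. -/
def IsConicalLimitPoint (Γ' : Subgroup SL(2, ℝ)) (p : RP1) : Prop :=
  ∃ K : Set ℍ, IsCompact K ∧ ∃ γ : ℕ → SL(2, ℝ), Function.Injective γ ∧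
    (∀ k, γ k ∈ Γ') ∧ ∀ k, (γ k • K ∩ ray p).Nonempty

/-- `p ∈ ℝP¹` is a uniform conical limit point of `Γ'` if the ray ending at `p` is covered by
the translates of a single compact subset of `ℍ` by an injective sequence in `Γ'`. -/
def IsUniformConicalLimitPoint (Γ' : Subgroup SL(2, ℝ)) (p : RP1) : Prop :=
  ∃ K : Set ℍ, IsCompact K ∧ ∃ γ : ℕ → SL(2, ℝ), Function.Injective γ ∧
    (∀ k, γ k ∈ Γ') ∧ ray p ⊆ ⋃ k, γ k • K

/-- The limit set of a subgroup of `SL(2, ℝ)`: the closure in `ℝP¹` of the set of fixed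
points of hyperbolic elements of the subgroup. -/
def limitSet (Γ' : Subgroup SL(2, ℝ)) : Set RP1 :=
  closure {p : RP1 | ∃ g ∈ Γ', IsHyperbolic g ∧ sl2Act g p = p}

/-- A discrete subgroup of `SL(2, ℝ)` acts properly discontinuously on `ℍ`: only finitely many of
its elements move a point of a given compact set into another given compact set. -/
theorem finite_setOf_smul_inter_nonempty (Γ : Subgroup SL(2, ℝ)) (hdisc : DiscreteTopology Γ)
    {K L : Set ℍ} (hK : IsCompact K) (hL : IsCompact L) :
    {g : SL(2, ℝ) | g ∈ Γ ∧ (g • K ∩ L).Nonempty}.Finite := by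
  have hΓ : ProperlyDiscontinuousSMul Γ ℍ :=
    @UpperHalfPlane.instProperlyDiscontinuousSL2RSubgroup Γ hdisc
  refine ((hΓ.finite_disjoint_inter_image hK hL).image Subtype.val).subset ?_
  rintro g ⟨hg, hne⟩
  exact ⟨⟨g, hg⟩, hne, rfl⟩

/-- **Proposition 2.1.** Let `Γ` be a non-elementary discrete purely hyperbolic subgroup of
`SL(2, ℝ)` and let `Φ` and `Θ` be nontrivial subgroups of `Γ`. Then every point of `ℝP¹`
that is both a conical limit point of `Φ` and a uniform conical limit point of `Θ` is a
conical limit point of `Φ ∩ Θ`. -/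
theorem conicalLimit_inter_of_conical_uniformConical
    (Γ : Subgroup SL(2, ℝ)) (hdisc : DiscreteTopology Γ)
    (hPH : PurelyHyperbolic Γ) (hNE : IsNonElementary Γ)
    (Φ Θ : Subgroup SL(2, ℝ)) (hΦΓ : Φ ≤ Γ) (hΘΓ : Θ ≤ Γ)
    (hΦnt : Φ ≠ ⊥) (hΘnt : Θ ≠ ⊥)
    (p : RP1) (hpΦ : IsConicalLimitPoint Φ p) (hpΘ : IsUniformConicalLimitPoint Θ p) :
    IsConicalLimitPoint (Φ ⊓ Θ) p := by
  obtain ⟨K, hK, φ, hφinj, hφ, hφray⟩ := hpΦ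
  obtain ⟨L, hL, θ, -, hθ, hθray⟩ := hpΘ
  choose z hzK hzray using hφray
  choose n hn using fun k => Set.mem_iUnion.mp (hθray (hzray k))
  -- The elements `(φ k)⁻¹ * θ (n k)` move a point of `L` into `K`, so one of them recurs.
  have hfin := finite_setOf_smul_inter_nonempty Γ hdisc hL hK
  have hmem (k : ℕ) :
      (φ k)⁻¹ * θ (n k) ∈ {g : SL(2, ℝ) | g ∈ Γ ∧ (g • L ∩ K).Nonempty} := by
    refine ⟨Γ.mul_mem (Γ.inv_mem (hΦΓ (hφ k))) (hΘΓ (hθ _)), (φ k)⁻¹ • z k, ?_,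
      Set.mem_smul_set_iff_inv_smul_mem.mp (hzK k)⟩
    rw [mul_smul]
    exact Set.smul_mem_smul_set (hn k)
  have := hfin.to_subtype
  obtain ⟨g, hg⟩ := Finite.exists_infinite_fiber (Set.codRestrict _ _ hmem)
  rw [Set.infinite_coe_iff] at hg
  have hgk {k : ℕ} (hk : k ∈ Set.codRestrict _ _ hmem ⁻¹' {g}) : θ (n k) = φ k * g := by
    rw [← congrArg Subtype.val hk, Set.val_codRestrict_apply, mul_inv_cancel_left]
  obtain ⟨a, ha⟩ := hg.nonempty
  let e := hg.natEmbedding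
  refine ⟨φ a • K, hK.smul _, fun j => φ (e j) * (φ a)⁻¹, fun i j hij =>
    e.injective (Subtype.ext (hφinj (mul_right_cancel hij))), fun j => ⟨?_, ?_⟩, fun j =>
    ⟨z (e j), ?_, hzray _⟩⟩
  · exact Φ.mul_mem (hφ _) (Φ.inv_mem (hφ a))
  · have hquot : φ (e j) * (φ a)⁻¹ = θ (n (e j)) * (θ (n a))⁻¹ := by
      rw [hgk (e j).2, hgk ha]
      group
    change φ (e j) * (φ a)⁻¹ ∈ Θ
    exact hquot ▸ Θ.mul_mem (hθ _) (Θ.inv_mem (hθ _))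
  · rw [smul_smul, inv_mul_cancel_right]
    exact hzK _

end
end

section
/- Let Γ be a discrete purely hyperbolic subgroup of SL(2,ℝ), let Φ be a nontrivial subgroup of Γ, let p ∈ ℝP¹ be a conical limit point of Φ, and let γ be a non-identity element of Γ with γ · p = p. Then there exists an integer m ≥ 1 with γ^m ∈ Φ. -/
open scoped MatrixGroups LinearAlgebra.Projectivization UpperHalfPlane Pointwise
open Matrix

noncomputable section

section UpperTriangular

variable {g : SL(2, ℝ)}

lemma mul_eq_one_of_lower_left_eq_zero (h : g 1 0 = 0) : g 0 0 * g 1 1 = 1 := by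
  have := g.det_coe
  rw [Matrix.det_fin_two, h] at this
  linarith

lemma coe_smul_of_lower_left_eq_zero (h : g 1 0 = 0) (z : ℍ) :
    ((g • z : ℍ) : ℂ) = ((g 0 0 ^ 2 : ℝ) : ℂ) * z + ((g 0 0 * g 0 1 : ℝ) : ℂ) := by
  have hd := mul_eq_one_of_lower_left_eq_zero h
  have hdc : (g 0 0 : ℂ) * (g 1 1 : ℂ) = 1 := by exact_mod_cast hd
  have h0 : (g 1 1 : ℂ) ≠ 0 := right_ne_zero_of_mul_eq_one hdc
  rw [UpperHalfPlane.coe_specialLinearGroup_apply]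
  simp only [Algebra.algebraMap_self, RingHom.id_apply, h, Complex.ofReal_zero, zero_mul, zero_add]
  rw [div_eq_iff h0]
  push_cast
  linear_combination (-(g 0 0 : ℂ) * z - (g 0 1 : ℂ)) * hdc

lemma im_smul_of_lower_left_eq_zero (h : g 1 0 = 0) (z : ℍ) :
    (g • z).im = g 0 0 ^ 2 * z.im := by
  have := congrArg Complex.im (coe_smul_of_lower_left_eq_zero h z)
  rwa [Complex.add_im, Complex.im_ofReal_mul, Complex.ofReal_im, add_zero] at this

lemma re_smul_of_lower_left_eq_zero (h : g 1 0 = 0) (z : ℍ) :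
    (g • z).re = g 0 0 ^ 2 * z.re + g 0 0 * g 0 1 := by
  have := congrArg Complex.re (coe_smul_of_lower_left_eq_zero h z)
  rwa [Complex.add_re, Complex.re_ofReal_mul, Complex.ofReal_re] at this

lemma im_pow_smul_of_lower_left_eq_zero (h : g 1 0 = 0) (z : ℍ) (n : ℕ) :
    (g ^ n • z).im = (g 0 0 ^ 2) ^ n * z.im := by
  induction n with
  | zero => simp
  | succ n ih => rw [pow_succ', mul_smul, im_smul_of_lower_left_eq_zero h, ih]; ring

lemma re_pow_smul_of_lower_left_eq_zero (h : g 1 0 = 0) (z : ℍ) {x₀ : ℝ}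
    (hx₀ : g 0 0 ^ 2 * x₀ + g 0 0 * g 0 1 = x₀) (n : ℕ) :
    (g ^ n • z).re - x₀ = (g 0 0 ^ 2) ^ n * (z.re - x₀) := by
  induction n with
  | zero => simp
  | succ n ih =>
    rw [pow_succ', mul_smul, re_smul_of_lower_left_eq_zero h]
    linear_combination g 0 0 ^ 2 * ih + hx₀

end UpperTriangular

lemma isCompact_upperHalfPlane_rectangle (A B c d : ℝ) (hc : 0 < c) :
    IsCompact {z : ℍ | z.re ∈ Set.Icc A B ∧ z.im ∈ Set.Icc c d} := by
  rw [UpperHalfPlane.isEmbedding_coe.isCompact_iff]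
  convert! (isCompact_Icc (a := A) (b := B)).reProdIm (isCompact_Icc (a := c) (b := d)) using 1
  ext w
  constructor
  · rintro ⟨z, hz, rfl⟩
    exact hz
  · rintro ⟨h1, h2⟩
    exact ⟨⟨w, hc.trans_le h2.1⟩, ⟨h1, h2⟩, rfl⟩

lemma exists_compact_pow_smul_mem_of_contracting {g : SL(2, ℝ)} (h : g 1 0 = 0)
    (hg : g 0 0 ^ 2 < 1) :
    ∃ K : Set ℍ, IsCompact K ∧ ∀ z : ℍ, z.re = 0 → 1 ≤ z.im → ∃ n : ℕ, g ^ n • z ∈ K := by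
  have h0 : g 0 0 ≠ 0 := left_ne_zero_of_mul_eq_one (mul_eq_one_of_lower_left_eq_zero h)
  have hpos : 0 < g 0 0 ^ 2 := by positivity
  obtain ⟨x₀, hx₀⟩ : ∃ x₀ : ℝ, g 0 0 ^ 2 * x₀ + g 0 0 * g 0 1 = x₀ := by
    refine ⟨g 0 0 * g 0 1 / (1 - g 0 0 ^ 2), ?_⟩
    have : 1 - g 0 0 ^ 2 ≠ 0 := by linarith
    field_simp
    ring
  refine ⟨_, isCompact_upperHalfPlane_rectangle (x₀ - |x₀|) (x₀ + |x₀|) 1 (1 / g 0 0 ^ 2) one_pos,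
    fun z hre him ↦ ?_⟩
  have hzpos := z.im_pos
  obtain ⟨n, hn1, hn2⟩ := exists_nat_pow_near_of_lt_one (x := 1 / z.im) (by positivity)
    (by rw [div_le_one hzpos]; exact him) hpos hg
  have hre' := re_pow_smul_of_lower_left_eq_zero h z hx₀ n
  have hpow : (g 0 0 ^ 2) ^ n ≤ 1 := pow_le_one₀ hpos.le hg.le
  have habs : |(g ^ n • z).re - x₀| ≤ |x₀| := by
    rw [hre', hre, zero_sub, abs_mul, abs_neg, abs_of_nonneg (by positivity)]
    exact mul_le_of_le_one_left (abs_nonneg _) hpow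
  rw [abs_le] at habs
  refine ⟨n, ⟨by linarith, by linarith⟩, ?_⟩
  rw [im_pow_smul_of_lower_left_eq_zero h]
  rw [div_le_iff₀ hzpos] at hn2
  rw [lt_div_iff₀ hzpos, pow_succ] at hn1
  refine ⟨hn2, ?_⟩
  rw [le_div_iff₀ hpos]
  linarith

lemma exists_compact_zpow_smul_mem {g : SL(2, ℝ)} (h : g 1 0 = 0) (hg : IsHyperbolic g) :
    ∃ K : Set ℍ, IsCompact K ∧ ∀ z : ℍ, z.re = 0 → 1 ≤ z.im → ∃ n : ℤ, g ^ n • z ∈ K := by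
  have hd := mul_eq_one_of_lower_left_eq_zero h
  rcases lt_trichotomy (g 0 0 ^ 2) 1 with h1 | h1 | h1
  · obtain ⟨K, hK, hmem⟩ := exists_compact_pow_smul_mem_of_contracting h h1
    refine ⟨K, hK, fun z hre him ↦ ?_⟩
    obtain ⟨n, hn⟩ := hmem z hre him
    exact ⟨n, by rwa [zpow_natCast]⟩
  · exfalso
    have heq : g 1 1 = g 0 0 := by linear_combination g 0 0 * hd - g 1 1 * h1
    have hsq : (g 0 0 + g 0 0) ^ 2 ≤ 2 ^ 2 := by nlinarith
    rw [_root_.IsHyperbolic, Matrix.trace_fin_two] at hg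
    have hle := abs_le_of_sq_le_sq hsq zero_le_two
    have : |g 0 0 + g 1 1| ≤ 2 := by rw [heq]; exact hle
    exact absurd hg this.not_gt
  · have hinv10 : g⁻¹ 1 0 = 0 := by simp [Matrix.SpecialLinearGroup.SL2_inv_expl, h]
    have hinv00 : g⁻¹ 0 0 = g 1 1 := by simp [Matrix.SpecialLinearGroup.SL2_inv_expl]
    have hlt : g⁻¹ 0 0 ^ 2 < 1 := by
      rw [hinv00]
      have : g 0 0 ^ 2 * g 1 1 ^ 2 = 1 := by rw [← mul_pow, hd, one_pow]
      nlinarith [sq_nonneg (g 1 1)]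
    obtain ⟨K, hK, hmem⟩ := exists_compact_pow_smul_mem_of_contracting hinv10 hlt
    refine ⟨K, hK, fun z hre him ↦ ?_⟩
    obtain ⟨n, hn⟩ := hmem z hre him
    exact ⟨-n, by rwa [_root_.zpow_neg, zpow_natCast, ← inv_pow]⟩

lemma exists_mulVec_rep_eq_smul {g : SL(2, ℝ)} {p : RP1} (h : sl2Act g p = p) :
    ∃ c : ℝ, (g : Matrix (Fin 2) (Fin 2) ℝ) *ᵥ p.rep = c • p.rep := by
  rw [sl2Act] at h
  nth_rewrite 1 2 [← p.mk_rep] at h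
  rw [Projectivization.map_mk, Projectivization.mk_eq_mk_iff'] at h
  obtain ⟨c, hc⟩ := h
  exact ⟨c, hc.symm⟩

/-- The inversion sending `x` to `∞` and the vertical ray ending at `x` to the one at `∞`. -/
def invertAt (x : ℝ) : SL(2, ℝ) := ⟨!![0, -1; 1, -x], by simp⟩

lemma coe_invertAt (x : ℝ) :
    (invertAt x : Matrix (Fin 2) (Fin 2) ℝ) = !![0, -1; 1, -x] := rfl

lemma coe_inv_invertAt (x : ℝ) :
    ((invertAt x)⁻¹ : SL(2, ℝ)).1 = !![-x, 1; -1, 0] := by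
  rw [Matrix.SpecialLinearGroup.coe_inv, coe_invertAt, Matrix.adjugate_fin_two_of]
  simp

lemma coe_invertAt_smul {x : ℝ} {z : ℍ} (hz : z.re = x) :
    ((invertAt x • z : ℍ) : ℂ) = ((z.im⁻¹ : ℝ) : ℂ) * Complex.I := by
  have hzx : (z : ℂ) = x + z.im * Complex.I := by
    rw [← hz]; exact (Complex.re_add_im (z : ℂ)).symm
  have him : (z.im : ℂ) ≠ 0 := by exact_mod_cast z.im_pos.ne'
  rw [UpperHalfPlane.coe_specialLinearGroup_apply, hzx]
  simp [invertAt]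
  field_simp
  simp

lemma exists_compact_zpow_smul_mem_of_mem_ray {g : SL(2, ℝ)} (hg : IsHyperbolic g) {p : RP1}
    (hp : sl2Act g p = p) :
    ∃ K : Set ℍ, IsCompact K ∧ ∀ z ∈ ray p, ∃ n : ℤ, g ^ n • z ∈ K := by
  obtain ⟨c, hc⟩ := exists_mulVec_rep_eq_smul hp
  have hc0 := congrFun hc 0
  have hc1 := congrFun hc 1
  simp only [Matrix.mulVec, dotProduct, Fin.sum_univ_two, Pi.smul_apply, smul_eq_mul] at hc0 hc1
  by_cases h1 : p.rep 1 = 0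
  · have h0 : p.rep 0 ≠ 0 := fun h0 ↦ p.rep_nonzero (by ext i; fin_cases i <;> simp [h0, h1])
    have hg10 : g 1 0 = 0 := by simpa [h1, h0] using hc1
    obtain ⟨K, hK, hmem⟩ := exists_compact_zpow_smul_mem hg10 hg
    refine ⟨K, hK, fun z hz ↦ ?_⟩
    rw [ray, if_pos h1] at hz
    exact hmem z hz.1 hz.2
  · set x := p.rep 0 / p.rep 1 with hx
    have hx0 : p.rep 0 = x * p.rep 1 := by rw [hx]; field_simp
    rw [hx0] at hc0 hc1
    have e1 : g 1 0 * x + g 1 1 = c := mul_right_cancel₀ h1 (by linear_combination hc1)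
    have e0 : g 0 0 * x + g 0 1 = c * x := mul_right_cancel₀ h1 (by linear_combination hc0)
    set t := invertAt x with ht
    have h10 : (t * g * t⁻¹) 1 0 = 0 := by
      rw [Matrix.SpecialLinearGroup.coe_mul, Matrix.SpecialLinearGroup.coe_mul, ht,
        coe_inv_invertAt, coe_invertAt]
      simp only [Matrix.mul_apply, Fin.sum_univ_two, Matrix.of_apply, Matrix.cons_val',
        Matrix.cons_val_zero, Matrix.cons_val_one, Matrix.cons_val_fin_one]
      linear_combination x * e1 - e0
    have hhyp : IsHyperbolic (t * g * t⁻¹) := by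
      rw [_root_.IsHyperbolic, Matrix.SpecialLinearGroup.coe_mul, Matrix.trace_mul_comm,
        ← Matrix.SpecialLinearGroup.coe_mul, inv_mul_cancel_left]
      exact hg
    obtain ⟨K, hK, hmem⟩ := exists_compact_zpow_smul_mem h10 hhyp
    refine ⟨(t⁻¹ • ·) '' K, hK.image (continuous_const_smul _), fun z hz ↦ ?_⟩
    rw [ray, if_neg h1] at hz
    have key := coe_invertAt_smul hz.1
    obtain ⟨n, hn⟩ := hmem (t • z)
      ((congrArg Complex.re key).trans (by simp))
      (((one_le_inv₀ z.im_pos).2 hz.2).trans_eq ((congrArg Complex.im key).trans (by simp)).symm)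
    refine ⟨n, _, hn, ?_⟩
    rw [conj_zpow]
    simp [mul_smul]

lemma finite_smul_inter_nonempty {Γ : Subgroup SL(2, ℝ)} (hdisc : DiscreteTopology Γ)
    {K L : Set ℍ} (hK : IsCompact K) (hL : IsCompact L) :
    {g : SL(2, ℝ) | g ∈ Γ ∧ (g • K ∩ L).Nonempty}.Finite := by
  have := @UpperHalfPlane.instProperlyDiscontinuousSL2RSubgroup Γ hdisc
  refine ((this.finite_disjoint_inter_image hK hL).image Subtype.val).subset ?_
  rintro g ⟨hg, hne⟩
  exact ⟨⟨g, hg⟩, hne, rfl⟩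

/-- **Corollary 2.3.** Let `Γ` be a discrete purely hyperbolic subgroup of `SL(2, ℝ)`, `Φ` a
nontrivial subgroup of `Γ`, `p` a conical limit point of `Φ`, and `γ` a non-identity element
of `Γ` fixing `p`. Then some positive power of `γ` lies in `Φ`. -/
theorem pow_mem_of_fixes_conicalLimitPoint
    (Γ : Subgroup SL(2, ℝ)) (hdisc : DiscreteTopology Γ) (hPH : PurelyHyperbolic Γ)
    (Φ : Subgroup SL(2, ℝ)) (hΦΓ : Φ ≤ Γ) (hΦnt : Φ ≠ ⊥)
    (p : RP1) (hp : IsConicalLimitPoint Φ p)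
    (γ : SL(2, ℝ)) (hγΓ : γ ∈ Γ) (hγ1 : γ ≠ 1) (hγp : sl2Act γ p = p) :
    ∃ m : ℕ, 1 ≤ m ∧ γ ^ m ∈ Φ := by
  obtain ⟨L, hL, hLmem⟩ := exists_compact_zpow_smul_mem_of_mem_ray (hPH γ hγΓ hγ1) hγp
  obtain ⟨K, hK, φ, hφinj, hφΦ, hφne⟩ := hp
  have hreturn : ∀ k, ∃ n : ℤ, ((γ ^ n * φ k) • K ∩ L).Nonempty := by
    intro k
    obtain ⟨z, hzK, hzr⟩ := hφne k
    obtain ⟨n, hn⟩ := hLmem z hzr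
    exact ⟨n, γ ^ n • z, by rw [mul_smul]; exact Set.smul_mem_smul_set hzK, hn⟩
  choose n hn using hreturn
  obtain ⟨k, -, l, -, hkl, heq⟩ := Set.infinite_univ.exists_ne_map_eq_of_mapsTo
    (f := fun k : ℕ ↦ γ ^ n k * φ k) (t := {g | g ∈ Γ ∧ (g • K ∩ L).Nonempty})
    (fun k _ ↦ ⟨Γ.mul_mem (Γ.zpow_mem hγΓ _) (hΦΓ (hφΦ k)), hn k⟩)
    (finite_smul_inter_nonempty hdisc hK hL)
  have hmem : γ ^ (n l - n k) ∈ Φ := by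
    have : γ ^ (n l - n k) = φ k * (φ l)⁻¹ := by
      rw [sub_eq_neg_add, _root_.zpow_add, _root_.zpow_neg, inv_mul_eq_iff_eq_mul, ← mul_assoc,
        eq_mul_inv_iff_mul_eq]
      exact heq.symm
    rw [this]
    exact Φ.mul_mem (hφΦ k) (Φ.inv_mem (hφΦ l))
  have hne : n l - n k ≠ 0 := by
    intro h0
    have hnkl : n l = n k := sub_eq_zero.1 h0
    simp only [hnkl] at heq
    exact hkl (hφinj (mul_left_cancel heq))
  refine ⟨(n l - n k).natAbs, Nat.one_le_iff_ne_zero.2 (Int.natAbs_ne_zero.2 hne), ?_⟩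
  rcases Int.natAbs_eq (n l - n k) with h | h
  · rwa [h, zpow_natCast] at hmem
  · rwa [h, _root_.zpow_neg, zpow_natCast, inv_mem_iff] at hmem

end
end

section
/- For every nontrivial finitely generated discrete purely hyperbolic subgroup Γ of SL(2,ℝ) with Λ(Γ) = ℝP¹, there exist non-elementary subgroups Φ and Θ of Γ such that Φ ∩ Θ is the trivial subgroup and Λ(Φ) ∩ Λ(Θ) contains exactly two points. In particular, Λ(Φ ∩ Θ) ≠ Λ(Φ) ∩ Λ(Θ) for this Φ and Θ. -/
open scoped MatrixGroups LinearAlgebra.Projectivization UpperHalfPlane Pointwise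
open Matrix

noncomputable section

/-- The linear action of `SL(2, ℝ)` on `ℝ²`. -/
def vecAct (g : SL(2, ℝ)) (w : Fin 2 → ℝ) : Fin 2 → ℝ :=
  (g : Matrix (Fin 2) (Fin 2) ℝ) *ᵥ w

lemma vecAct_mul (g h : SL(2, ℝ)) (w : Fin 2 → ℝ) :
    vecAct (g * h) w = vecAct g (vecAct h w) := by
  simp only [vecAct, Matrix.SpecialLinearGroup.coe_mul, Matrix.mulVec_mulVec]

lemma vecAct_one (w : Fin 2 → ℝ) : vecAct 1 w = w := by
  simp [vecAct]

lemma vecAct_smul (g : SL(2, ℝ)) (c : ℝ) (w : Fin 2 → ℝ) :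
    vecAct g (c • w) = c • vecAct g w := by
  simp [vecAct, Matrix.mulVec_smul]

lemma vecAct_inv_vecAct (g : SL(2, ℝ)) (w : Fin 2 → ℝ) : vecAct g⁻¹ (vecAct g w) = w := by
  rw [← vecAct_mul, inv_mul_cancel, vecAct_one]

lemma vecAct_vecAct_inv (g : SL(2, ℝ)) (w : Fin 2 → ℝ) : vecAct g (vecAct g⁻¹ w) = w := by
  rw [← vecAct_mul, mul_inv_cancel, vecAct_one]

lemma vecAct_ne_zero (g : SL(2, ℝ)) {w : Fin 2 → ℝ} (hw : w ≠ 0) : vecAct g w ≠ 0 := by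
  intro h
  apply hw
  rw [← vecAct_inv_vecAct g w, h]
  simp [vecAct]

/-- The standard area form on `ℝ²`. -/
def wedge (w z : Fin 2 → ℝ) : ℝ := w 0 * z 1 - w 1 * z 0

lemma wedge_vecAct (g : SL(2, ℝ)) (w z : Fin 2 → ℝ) :
    wedge (vecAct g w) (vecAct g z) = wedge w z := by
  have hg := g.det_coe
  rw [Matrix.det_fin_two] at hg
  simp only [wedge, vecAct, Matrix.mulVec, dotProduct, Fin.sum_univ_two]
  linear_combination (w 0 * z 1 - w 1 * z 0) * hg

lemma wedge_smul_left (c : ℝ) (w z : Fin 2 → ℝ) : wedge (c • w) z = c * wedge w z := by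
  simp only [wedge, Pi.smul_apply, smul_eq_mul]; ring

lemma wedge_smul_right (c : ℝ) (w z : Fin 2 → ℝ) : wedge w (c • z) = c * wedge w z := by
  simp only [wedge, Pi.smul_apply, smul_eq_mul]; ring

lemma wedge_self (w : Fin 2 → ℝ) : wedge w w = 0 := by
  simp only [wedge]; ring

lemma wedge_comm (w z : Fin 2 → ℝ) : wedge w z = -wedge z w := by
  simp only [wedge]; ring

lemma ne_zero_of_wedge_left {w z : Fin 2 → ℝ} (h : wedge w z ≠ 0) : w ≠ 0 := by
  rintro rfl; simp [wedge] at h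

lemma ne_zero_of_wedge_right {w z : Fin 2 → ℝ} (h : wedge w z ≠ 0) : z ≠ 0 := by
  rintro rfl; simp [wedge] at h

@[fun_prop]
lemma continuous_wedge {X : Type*} [TopologicalSpace X] {f g : X → Fin 2 → ℝ}
    (hf : Continuous f) (hg : Continuous g) : Continuous fun x => wedge (f x) (g x) := by
  unfold wedge; fun_prop

lemma exists_smul_of_wedge_eq_zero {w z : Fin 2 → ℝ} (hz : z ≠ 0) (h : wedge w z = 0) :
    ∃ c : ℝ, c • z = w := by
  simp only [wedge] at h
  by_cases h0 : z 0 = 0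
  · have h1 : z 1 ≠ 0 := by
      intro h1; apply hz; ext i; fin_cases i <;> simp [h0, h1]
    refine ⟨w 1 / z 1, ?_⟩
    have : w 0 = 0 := by simpa [h0, h1] using h
    ext i; fin_cases i <;> simp [h0, h1, this]
  · refine ⟨w 0 / z 0, ?_⟩
    ext i; fin_cases i
    · simp [h0]
    · simp; field_simp; linarith

/-- The expansion of a vector in a basis of `ℝ²`. -/
lemma wedge_expansion {u v : Fin 2 → ℝ} (h : wedge u v ≠ 0) (w : Fin 2 → ℝ) :
    w = (wedge w v / wedge u v) • u + (wedge u w / wedge u v) • v := by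
  ext i
  have : wedge u v * w i = wedge w v * u i + wedge u w * v i := by
    fin_cases i <;> simp [wedge] <;> ring
  simp only [Pi.add_apply, Pi.smul_apply, smul_eq_mul]
  field_simp
  linarith

/-- The quadratic form vanishing on the lines spanned by `u` and `v`. -/
def axisForm (u v w : Fin 2 → ℝ) : ℝ := wedge w v * wedge u w

lemma axisForm_smul (u v w : Fin 2 → ℝ) (c : ℝ) :
    axisForm u v (c • w) = c ^ 2 * axisForm u v w := by
  simp only [axisForm, wedge_smul_left, wedge_smul_right]; ring

lemma axisForm_neg_right (u v w : Fin 2 → ℝ) : axisForm u (-v) w = -axisForm u v w := by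
  simp only [axisForm, wedge, Pi.neg_apply]; ring

@[fun_prop]
lemma continuous_axisForm (u v : Fin 2 → ℝ) : Continuous (axisForm u v) := by
  unfold axisForm; fun_prop

/-- `g` acts on `ℝ²` with expanding eigenvector `u` and contracting eigenvector `v`. -/
structure IsAxis (g : SL(2, ℝ)) (l : ℝ) (u v : Fin 2 → ℝ) : Prop where
  one_lt : 1 < |l|
  wedge_ne : wedge u v ≠ 0
  left : vecAct g u = l • u
  right : vecAct g v = l⁻¹ • v

namespace IsAxis

variable {g : SL(2, ℝ)} {l : ℝ} {u v : Fin 2 → ℝ}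

lemma ne_zero (H : IsAxis g l u v) : l ≠ 0 := by
  rintro rfl; simpa using H.one_lt.trans_le' zero_le_one

lemma inv (H : IsAxis g l u v) : IsAxis g⁻¹ l v u where
  one_lt := H.one_lt
  wedge_ne := by rw [wedge_comm]; exact neg_ne_zero.2 H.wedge_ne
  left := by
    have := congrArg (vecAct g⁻¹) H.right
    rw [vecAct_inv_vecAct, vecAct_smul] at this
    conv_rhs => rw [this]
    rw [smul_smul, mul_inv_cancel₀ H.ne_zero, one_smul]
  right := by
    have := congrArg (vecAct g⁻¹) H.left
    rw [vecAct_inv_vecAct, vecAct_smul] at this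
    conv_rhs => rw [this]
    rw [smul_smul, inv_mul_cancel₀ H.ne_zero, one_smul]

lemma pow (H : IsAxis g l u v) {n : ℕ} (hn : n ≠ 0) : IsAxis (g ^ n) (l ^ n) u v where
  one_lt := by rw [abs_pow]; exact one_lt_pow₀ H.one_lt hn
  wedge_ne := H.wedge_ne
  left := by
    clear hn
    induction n with
    | zero => simp [vecAct_one]
    | succ n ih => rw [pow_succ, vecAct_mul, H.left, vecAct_smul, ih, smul_smul, pow_succ']
  right := by
    clear hn
    induction n with
    | zero => simp [vecAct_one]
    | succ n ih =>
      rw [pow_succ, vecAct_mul, H.right, vecAct_smul, ih, smul_smul, pow_succ', mul_inv]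

lemma conj (H : IsAxis g l u v) (h : SL(2, ℝ)) :
    IsAxis (h * g * h⁻¹) l (vecAct h u) (vecAct h v) where
  one_lt := H.one_lt
  wedge_ne := by rw [wedge_vecAct]; exact H.wedge_ne
  left := by rw [← vecAct_mul, inv_mul_cancel_right, vecAct_mul, H.left, vecAct_smul]
  right := by rw [← vecAct_mul, inv_mul_cancel_right, vecAct_mul, H.right, vecAct_smul]

lemma neg_right (H : IsAxis g l u v) : IsAxis g l u (-v) where
  one_lt := H.one_lt
  wedge_ne := by
    rw [← neg_one_smul ℝ, wedge_smul_right]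
    exact mul_ne_zero (by norm_num) H.wedge_ne
  left := H.left
  right := by rw [← neg_one_smul ℝ, vecAct_smul, H.right, smul_comm]

lemma wedge_left (H : IsAxis g l u v) (w : Fin 2 → ℝ) :
    wedge (vecAct g w) v = l * wedge w v := by
  have := wedge_vecAct g w v
  rw [H.right, wedge_smul_right] at this
  rw [← this, mul_inv_cancel_left₀ H.ne_zero]

lemma wedge_right (H : IsAxis g l u v) (w : Fin 2 → ℝ) :
    wedge u (vecAct g w) = l⁻¹ * wedge u w := by
  have := wedge_vecAct g u w
  rw [H.left, wedge_smul_left] at this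
  rw [← this, inv_mul_cancel_left₀ H.ne_zero]

lemma wedge_right' (H : IsAxis g l u v) (w : Fin 2 → ℝ) :
    wedge (vecAct g w) u = l⁻¹ * wedge w u := by
  rw [wedge_comm, H.wedge_right, wedge_comm w u]; ring

lemma axisForm_vecAct (H : IsAxis g l u v) (w : Fin 2 → ℝ) :
    axisForm u v (vecAct g w) = axisForm u v w := by
  have := H.ne_zero
  rw [axisForm, H.wedge_left, H.wedge_right, axisForm]
  field_simp

lemma axisForm_eq_zero (H : IsAxis g l u v) {w : Fin 2 → ℝ} (hw : wedge (vecAct g w) w = 0) :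
    axisForm u v w = 0 := by
  have hl := H.ne_zero
  have h1 : wedge (vecAct g w) w * wedge u v
      = wedge (vecAct g w) v * wedge u w - wedge u (vecAct g w) * wedge w v := by
    simp only [wedge]; ring
  rw [hw, H.wedge_left, H.wedge_right] at h1
  have h2 : (l - l⁻¹) * axisForm u v w = 0 := by
    rw [axisForm]; linear_combination -h1
  refine (mul_eq_zero.1 h2).resolve_left fun h3 => ?_
  have h4 : l ^ 2 = 1 := by field_simp at h3; linarith
  exact (one_lt_sq_iff_one_lt_abs l).2 H.one_lt |>.ne' h4

lemma ne_one (H : IsAxis g l u v) : g ≠ 1 := by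
  rintro rfl
  have h1 := H.left
  rw [vecAct_one] at h1
  have h2 : (l - 1) • u = 0 := by rw [sub_smul, ← h1, one_smul, sub_self]
  rcases smul_eq_zero.1 h2 with h3 | h3
  · have := H.one_lt
    rw [sub_eq_zero.1 h3] at this
    simp at this
  · exact ne_zero_of_wedge_left H.wedge_ne h3

open Filter Topology in
lemma tendsto (H : IsAxis g l u v) (w : Fin 2 → ℝ) :
    Tendsto (fun n : ℕ => (l⁻¹ ^ n) • vecAct (g ^ n) w) atTop
      (𝓝 ((wedge w v / wedge u v) • u)) := by
  have hl := H.ne_zero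
  have key : ∀ᶠ n : ℕ in atTop, (wedge w v / wedge u v) • u
      + (((l⁻¹) ^ 2) ^ n * (wedge u w / wedge u v)) • v = (l⁻¹ ^ n) • vecAct (g ^ n) w := by
    filter_upwards [eventually_ne_atTop 0] with n hn
    have H' := H.pow hn
    conv_rhs => rw [wedge_expansion H.wedge_ne (vecAct (g ^ n) w)]
    rw [H'.wedge_left, H'.wedge_right, smul_add, smul_smul, smul_smul]
    congr 2
    · field_simp; simp [hl]
    · rw [← inv_pow]; ring
  refine Tendsto.congr' key ?_
  have h1 : |l⁻¹ ^ 2| < 1 := by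
    rw [abs_pow, abs_inv]
    exact pow_lt_one₀ (by positivity) (inv_lt_one_of_one_lt₀ H.one_lt) two_ne_zero
  have h2 := (((tendsto_pow_atTop_nhds_zero_of_abs_lt_one h1).mul_const
    (wedge u w / wedge u v)).smul_const v).const_add ((wedge w v / wedge u v) • u)
  simpa using h2

end IsAxis

lemma exists_eigenvector {g : SL(2, ℝ)} {l : ℝ}
    (hl : l ^ 2 - Matrix.trace (g : Matrix (Fin 2) (Fin 2) ℝ) * l + 1 = 0) :
    ∃ u ≠ 0, vecAct g u = l • u := by
  have hdet : ((g : Matrix (Fin 2) (Fin 2) ℝ) - l • 1).det = 0 := by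
    have hg := g.det_coe
    rw [Matrix.det_fin_two] at hg
    rw [Matrix.trace_fin_two] at hl
    simp [Matrix.det_fin_two]
    linear_combination hg + hl
  obtain ⟨u, hu, h⟩ := Matrix.exists_mulVec_eq_zero_iff.2 hdet
  refine ⟨u, hu, ?_⟩
  rw [Matrix.sub_mulVec, Matrix.smul_mulVec, Matrix.one_mulVec, sub_eq_zero] at h
  exact h

lemma trace_eq_two_of_fixed {g : SL(2, ℝ)} {u : Fin 2 → ℝ} (hu : u ≠ 0) (h : vecAct g u = u) :
    Matrix.trace (g : Matrix (Fin 2) (Fin 2) ℝ) = 2 := by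
  have hdet : ((g : Matrix (Fin 2) (Fin 2) ℝ) - 1).det = 0 := by
    refine Matrix.exists_mulVec_eq_zero_iff.1 ⟨u, hu, ?_⟩
    rw [Matrix.sub_mulVec, Matrix.one_mulVec, sub_eq_zero]
    exact h
  have hg := g.det_coe
  rw [Matrix.det_fin_two] at hg
  simp [Matrix.det_fin_two] at hdet
  rw [Matrix.trace_fin_two]
  linarith

lemma exists_isAxis_of_isHyperbolic {g : SL(2, ℝ)} (hg : IsHyperbolic g) :
    ∃ l u v, IsAxis g l u v := by
  have main : ∃ l : ℝ, 1 < |l| ∧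
      l ^ 2 - Matrix.trace (g : Matrix (Fin 2) (Fin 2) ℝ) * l + 1 = 0 := by
    unfold _root_.IsHyperbolic at hg
    generalize Matrix.trace (g : Matrix (Fin 2) (Fin 2) ℝ) = t at hg ⊢
    have hd : 0 ≤ t ^ 2 - 4 := by nlinarith [sq_abs t]
    have hs := Real.sq_sqrt hd
    have hs0 := Real.sqrt_nonneg (t ^ 2 - 4)
    rcases lt_abs.1 hg with ht | ht
    · refine ⟨(t + √(t ^ 2 - 4)) / 2, lt_abs.2 (Or.inl (by linarith)), by linarith⟩
    · refine ⟨(t - √(t ^ 2 - 4)) / 2, lt_abs.2 (Or.inr (by linarith)), by linarith⟩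
  obtain ⟨l, hl, hroot⟩ := main
  have hl0 : l ≠ 0 := by rintro rfl; simp at hroot
  obtain ⟨u, hu, hgu⟩ := exists_eigenvector hroot
  obtain ⟨v, hv, hgv⟩ := exists_eigenvector (g := g) (l := l⁻¹) (by
    field_simp; linarith)
  refine ⟨l, u, v, hl, fun huv => ?_, hgu, hgv⟩
  obtain ⟨c, rfl⟩ := exists_smul_of_wedge_eq_zero hv huv
  rw [vecAct_smul, hgv, smul_comm, ← sub_eq_zero, ← sub_smul] at hgu
  rcases smul_eq_zero.1 hgu with h3 | h3
  · have h4 : l ^ 2 = 1 := by field_simp at h3; linarith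
    exact (one_lt_sq_iff_one_lt_abs l).2 hl |>.ne' h4
  · exact hu h3

lemma commute_of_common_eigenvector {Γ : Subgroup SL(2, ℝ)} (hPH : PurelyHyperbolic Γ)
    {g h : SL(2, ℝ)} (hg : g ∈ Γ) (hh : h ∈ Γ) {x : Fin 2 → ℝ} (hx : x ≠ 0) {α β : ℝ}
    (hgx : vecAct g x = α • x) (hhx : vecAct h x = β • x) : g * h = h * g := by
  have hfix : vecAct ((h * g)⁻¹ * (g * h)) x = x := by
    rw [vecAct_mul, vecAct_mul g h, hhx, vecAct_smul, hgx, smul_comm, ← hhx, ← vecAct_smul,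
      ← hgx, ← vecAct_mul h g, vecAct_inv_vecAct]
  by_contra hne
  have hne' : (h * g)⁻¹ * (g * h) ≠ 1 := fun h1 => hne (inv_mul_eq_one.1 h1).symm
  have hyp := hPH _ (mul_mem (inv_mem (mul_mem hh hg)) (mul_mem hg hh)) hne'
  rw [_root_.IsHyperbolic, trace_eq_two_of_fixed hx hfix] at hyp
  norm_num at hyp

lemma wedge_ne_zero_of_axisForm_ne_zero {Γ : Subgroup SL(2, ℝ)} (hPH : PurelyHyperbolic Γ)
    {g h : SL(2, ℝ)} (hg : g ∈ Γ) (hh : h ∈ Γ) {l k : ℝ} {u v a b : Fin 2 → ℝ}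
    (Hg : IsAxis g l u v) (Hh : IsAxis h k a b) (ha : axisForm u v a ≠ 0) :
    wedge u b ≠ 0 := by
  intro hub
  obtain ⟨c, rfl⟩ := exists_smul_of_wedge_eq_zero (ne_zero_of_wedge_right Hh.wedge_ne) hub
  have hu := ne_zero_of_wedge_left Hg.wedge_ne
  have hcomm := commute_of_common_eigenvector hPH hg hh hu Hg.left (β := k⁻¹)
    (by rw [vecAct_smul, Hh.right, smul_comm])
  have h1 : vecAct h (vecAct g a) = k • vecAct g a := by
    rw [← vecAct_mul, ← hcomm, vecAct_mul, Hh.left, vecAct_smul]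
  have h2 := wedge_vecAct h (vecAct g a) a
  rw [h1, Hh.left, wedge_smul_left, wedge_smul_right] at h2
  have h3 : (k ^ 2 - 1) * wedge (vecAct g a) a = 0 := by linear_combination h2
  refine ha (Hg.axisForm_eq_zero ((mul_eq_zero.1 h3).resolve_left ?_))
  exact sub_ne_zero.2 ((one_lt_sq_iff_one_lt_abs k).2 Hh.one_lt).ne'

open Filter in
/-- In a purely hyperbolic group, the axis of an element with an endpoint on the positive side
of the axis of `g` can be used to move the axis of `g` to its positive side. -/
lemma exists_isAxis_axisForm_pos {Γ : Subgroup SL(2, ℝ)} (hPH : PurelyHyperbolic Γ)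
    {g h : SL(2, ℝ)} (hg : g ∈ Γ) (hh : h ∈ Γ) {l k : ℝ} {u v a b : Fin 2 → ℝ}
    (Hg : IsAxis g l u v) (Hh : IsAxis h k a b) (ha : 0 < axisForm u v a) :
    ∃ f ∈ Γ, ∃ x y, IsAxis f l x y ∧ 0 < axisForm u v x ∧ 0 < axisForm u v y := by
  have key : ∀ w, wedge w b ≠ 0 → ∀ᶠ n : ℕ in atTop, 0 < axisForm u v (vecAct (h ^ n) w) := by
    intro w hw
    have h1 := ((continuous_axisForm u v).tendsto _).comp (Hh.tendsto w)
    have h2 : 0 < axisForm u v ((wedge w b / wedge a b) • a) := by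
      rw [axisForm_smul]
      exact mul_pos (pow_two_pos_of_ne_zero (div_ne_zero hw Hh.wedge_ne)) ha
    filter_upwards [h1.eventually (lt_mem_nhds h2)] with n hn
    simp only [Function.comp, axisForm_smul] at hn
    exact pos_of_mul_pos_right hn (sq_nonneg _)
  have hu := wedge_ne_zero_of_axisForm_ne_zero hPH hg hh Hg Hh ha.ne'
  have hv := wedge_ne_zero_of_axisForm_ne_zero hPH (inv_mem hg) hh Hg.inv Hh (by
    have : axisForm v u a = axisForm u v a := by simp only [axisForm, wedge]; ring
    rw [this]; exact ha.ne')
  obtain ⟨n, h1, h2⟩ := ((key u hu).and (key v hv)).exists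
  exact ⟨_, mul_mem (mul_mem (pow_mem hh n) hg) (inv_mem (pow_mem hh n)), _, _,
    Hg.conj (h ^ n), h1, h2⟩

/-- `PingPongWord a o w` says that `w` is a reduced product of powers of the `a i`, whose first
syllable is a power of `a i` if `o = some i`, and which is empty if `o = none`. -/
inductive PingPongWord {ι : Type*} (a : ι → SL(2, ℝ)) : Option ι → SL(2, ℝ) → Prop
  | one : PingPongWord a none 1
  | cons {o : Option ι} {w : SL(2, ℝ)} (i : ι) (m : ℤ) (hm : m ≠ 0) (ho : o ≠ some i)
      (hw : PingPongWord a o w) : PingPongWord a (some i) (a i ^ m * w)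

section PingPong

variable {ι : Type*} {a : ι → SL(2, ℝ)} {X : ι → Set (Fin 2 → ℝ)}

lemma PingPongWord.exists_zpow_mul {o : Option ι} {w : SL(2, ℝ)} (hw : PingPongWord a o w)
    (i : ι) (m : ℤ) : ∃ o', PingPongWord a o' (a i ^ m * w) := by
  by_cases hm : m = 0
  · subst hm; exact ⟨o, by simpa using hw⟩
  by_cases ho : o = some i
  · subst ho
    cases hw with
    | cons _ m' hm' ho hw =>
      rw [← mul_assoc, ← _root_.zpow_add]
      by_cases h0 : m + m' = 0
      · exact ⟨_, by rw [h0, zpow_zero, one_mul]; exact hw⟩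
      · exact ⟨_, .cons i _ h0 ho hw⟩
  · exact ⟨_, .cons i m hm ho hw⟩

lemma exists_pingPongWord {w : SL(2, ℝ)} (hw : w ∈ Subgroup.closure (Set.range a)) :
    ∃ o, PingPongWord a o w := by
  induction hw using Subgroup.closure_induction_left with
  | one => exact ⟨_, .one⟩
  | mul_left x hx y _ ih =>
    obtain ⟨i, rfl⟩ := hx
    obtain ⟨o, ho⟩ := ih
    simpa using ho.exists_zpow_mul i 1
  | inv_mul_cancel x hx y _ ih =>
    obtain ⟨i, rfl⟩ := hx
    obtain ⟨o, ho⟩ := ih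
    simpa using ho.exists_zpow_mul i (-1)

lemma PingPongWord.vecAct_mem
    (hdisj : ∀ i j, i ≠ j → Disjoint (X i) (X j))
    (hX : ∀ i, ∀ m : ℤ, m ≠ 0 → ∀ x, x ≠ 0 → x ∉ X i → vecAct (a i ^ m) x ∈ X i)
    {o : Option ι} {w : SL(2, ℝ)} (hw : PingPongWord a o w)
    {x : Fin 2 → ℝ} (hx : x ≠ 0) (hxX : ∀ i, x ∉ X i) {i : ι} (hi : o = some i) :
    vecAct w x ∈ X i := by
  induction hw generalizing i with
  | one => simp at hi
  | @cons o w j m hm ho hw ih =>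
    obtain rfl : j = i := by simpa using hi
    rw [vecAct_mul]
    refine hX j m hm _ (vecAct_ne_zero _ hx) ?_
    cases o with
    | none => cases hw; rw [vecAct_one]; exact hxX j
    | some k =>
      have hk : k ≠ j := by simpa using ho
      exact Set.disjoint_left.1 (hdisj k j hk) (ih rfl)

/-- The ping-pong lemma: a nontrivial element of the group generated by the `a i` maps every
vector outside the `X i` into some `X i`. -/
lemma exists_vecAct_mem_of_pingPong
    (hdisj : ∀ i j, i ≠ j → Disjoint (X i) (X j))
    (hX : ∀ i, ∀ m : ℤ, m ≠ 0 → ∀ x, x ≠ 0 → x ∉ X i → vecAct (a i ^ m) x ∈ X i)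
    {w : SL(2, ℝ)} (hw : w ∈ Subgroup.closure (Set.range a))
    (hw1 : w ≠ 1) {x : Fin 2 → ℝ} (hx : x ≠ 0) (hxX : ∀ i, x ∉ X i) :
    ∃ i, vecAct w x ∈ X i := by
  obtain ⟨o, ho⟩ := exists_pingPongWord hw
  cases o with
  | none => cases ho; exact absurd rfl hw1
  | some i => exact ⟨i, PingPongWord.vecAct_mem hdisj hX ho hx hxX rfl⟩

lemma isNonElementary_of_pingPong
    (hdisj : ∀ i j, i ≠ j → Disjoint (X i) (X j))
    (hX : ∀ i, ∀ m : ℤ, m ≠ 0 → ∀ x, x ≠ 0 → x ∉ X i → vecAct (a i ^ m) x ∈ X i)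
    {i j : ι} (hij : i ≠ j) {x : Fin 2 → ℝ} (hx : x ≠ 0)
    (hxX : ∀ i, x ∉ X i) : IsNonElementary (Subgroup.closure (Set.range a)) := by
  rintro ⟨H, hfin, hcomm⟩
  have hmem (k : ι) : a k ∈ Subgroup.closure (Set.range a) := Subgroup.subset_closure ⟨k, rfl⟩
  obtain ⟨m, hm, -, hmH⟩ := Subgroup.exists_pow_mem_of_index_ne_zero hfin.index_ne_zero
    ⟨a i, hmem i⟩
  obtain ⟨n, hn, -, hnH⟩ := Subgroup.exists_pow_mem_of_index_ne_zero hfin.index_ne_zero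
    ⟨a j, hmem j⟩
  have hc : a i ^ (m : ℤ) * a j ^ (n : ℤ) = a j ^ (n : ℤ) * a i ^ (m : ℤ) := by
    have := congrArg Subtype.val (hcomm _ hmH _ hnH)
    simp only [zpow_natCast]
    exact this
  have step {p q : ι} (hpq : q ≠ p) {r s : ℕ} (hr : 0 < r) (hs : 0 < s) :
      vecAct (a p ^ (r : ℤ) * a q ^ (s : ℤ)) x ∈ X p := by
    rw [vecAct_mul]
    refine hX p _ (by exact_mod_cast hr.ne') _ (vecAct_ne_zero _ hx) ?_
    exact Set.disjoint_left.1 (hdisj q p hpq) (hX q _ (by exact_mod_cast hs.ne') _ hx (hxX q))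
  refine Set.disjoint_left.1 (hdisj i j hij) (step hij.symm hm hn) ?_
  rw [hc]
  exact step hij hn hm

end PingPong

/-- The union of the two lines spanned by `a` and `b`, thickened, without the origin. -/
def doubleCone (δ : ℝ) (a b : Fin 2 → ℝ) : Set (Fin 2 → ℝ) :=
  {w | |wedge w b| < δ * |wedge w a| ∨ |wedge w a| < δ * |wedge w b|}

lemma doubleCone_comm (δ : ℝ) (a b : Fin 2 → ℝ) : doubleCone δ a b = doubleCone δ b a := by
  ext w; exact or_comm

lemma IsAxis.pow_mem_doubleCone {h : SL(2, ℝ)} {l δ : ℝ} {a b : Fin 2 → ℝ}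
    (H : IsAxis h l a b) (hδ : 0 < δ) (hl : 1 < δ * |l|) {m : ℕ} (hm : m ≠ 0)
    {x : Fin 2 → ℝ} (hx : x ≠ 0) (hxJ : x ∉ doubleCone δ a b) :
    vecAct (h ^ m) x ∈ doubleCone δ a b := by
  have H' := H.pow hm
  have hlm : 1 < δ * |l ^ m| := by
    rw [abs_pow]
    exact hl.trans_le (mul_le_mul_of_nonneg_left (le_self_pow₀ H.one_lt.le hm) hδ.le)
  simp only [doubleCone, Set.mem_ofPred_eq, not_or, not_lt] at hxJ
  right
  rw [H'.wedge_left, H'.wedge_right', abs_mul, abs_mul, abs_inv]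
  have hL := H'.one_lt
  have hb : 0 < |wedge x b| := by
    refine abs_pos.2 fun hb => hx ?_
    have ha : wedge x a = 0 := by
      have := hxJ.1
      rw [hb, abs_zero] at this
      exact abs_eq_zero.1 (le_antisymm (nonpos_of_mul_nonpos_right this hδ) (abs_nonneg _))
    rw [wedge_expansion H.wedge_ne x, hb, wedge_comm a x, ha]
    simp
  generalize |l ^ m| = L at *
  have hL0 : 0 < L := by linarith
  rw [inv_mul_lt_iff₀ hL0]
  have h1 : |wedge x a| * δ ≤ |wedge x b| := by linarith [hxJ.1]
  have h2 : 1 < (δ * L) ^ 2 := by nlinarith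
  have h3 : |wedge x b| < |wedge x b| * (δ * L) ^ 2 := lt_mul_of_one_lt_right hb h2
  refine lt_of_mul_lt_mul_right ?_ hδ.le
  calc |wedge x a| * δ ≤ |wedge x b| := h1
    _ < |wedge x b| * (δ * L) ^ 2 := h3
    _ = L * (δ * (L * |wedge x b|)) * δ := by ring

lemma IsAxis.zpow_mem_doubleCone {h : SL(2, ℝ)} {l δ : ℝ} {a b : Fin 2 → ℝ}
    (H : IsAxis h l a b) (hδ : 0 < δ) (hl : 1 < δ * |l|) {m : ℤ} (hm : m ≠ 0)
    {x : Fin 2 → ℝ} (hx : x ≠ 0) (hxJ : x ∉ doubleCone δ a b) :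
    vecAct (h ^ m) x ∈ doubleCone δ a b := by
  obtain ⟨n, rfl | rfl⟩ := m.eq_nat_or_neg
  · rw [zpow_natCast]
    exact H.pow_mem_doubleCone hδ hl (by simpa using hm) hx hxJ
  · rw [_root_.zpow_neg, zpow_natCast, ← inv_pow]
    rw [doubleCone_comm] at hxJ ⊢
    exact H.inv.pow_mem_doubleCone hδ hl (by simpa using hm) hx hxJ

/-- The open cone on which `axisForm u v` is positive and the coordinates with respect to `u`
and `v` have ratio less than `C`. -/
def axisCone (C : ℝ) (u v : Fin 2 → ℝ) : Set (Fin 2 → ℝ) :=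
  {w | 0 < axisForm u v w ∧ |wedge w v| < C * |wedge w u| ∧ |wedge w u| < C * |wedge w v|}

lemma isOpen_axisCone (C : ℝ) (u v : Fin 2 → ℝ) : IsOpen (axisCone C u v) := by
  have h (y z : Fin 2 → ℝ) : IsOpen {w | |wedge w y| < C * |wedge w z|} :=
    isOpen_lt (by fun_prop) (by fun_prop)
  exact (isOpen_lt continuous_const (continuous_axisForm u v)).inter ((h v u).inter (h u v))

lemma smul_mem_axisCone {C : ℝ} {u v w : Fin 2 → ℝ} {c : ℝ} (hc : c ≠ 0)
    (hw : w ∈ axisCone C u v) : c • w ∈ axisCone C u v := by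
  obtain ⟨h1, h2, h3⟩ := hw
  have hc' := abs_pos.2 hc
  refine ⟨?_, ?_, ?_⟩
  · rw [axisForm_smul]; positivity
  all_goals
    rw [wedge_smul_left, wedge_smul_left, abs_mul, abs_mul]
    nlinarith

lemma exists_mem_axisCone {u v w : Fin 2 → ℝ} (hw : 0 < axisForm u v w) :
    ∃ C₀, ∀ C > C₀, w ∈ axisCone C u v := by
  have h1 : 0 < |wedge w v| := abs_pos.2 (left_ne_zero_of_mul hw.ne')
  have h2 : 0 < |wedge w u| := by
    rw [wedge_comm, abs_neg]; exact abs_pos.2 (right_ne_zero_of_mul hw.ne')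
  refine ⟨max (|wedge w v| / |wedge w u|) (|wedge w u| / |wedge w v|), fun C hC => ⟨hw, ?_, ?_⟩⟩
  · exact (div_lt_iff₀ h2).1 ((le_max_left _ _).trans_lt hC)
  · exact (div_lt_iff₀ h1).1 ((le_max_right _ _).trans_lt hC)

lemma exists_doubleCone_subset {C : ℝ} {u v a b : Fin 2 → ℝ} (hab : wedge a b ≠ 0)
    (ha : a ∈ axisCone C u v) (hb : b ∈ axisCone C u v) :
    ∃ δ > 0, doubleCone δ a b ⊆ axisCone C u v := by
  have key : ∀ {a b : Fin 2 → ℝ}, b ∈ axisCone C u v →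
      ∀ᶠ ε : ℝ in nhds 0, b + ε • a ∈ axisCone C u v := by
    intro a b hb
    have hc : Continuous fun ε : ℝ => b + ε • a := by fun_prop
    exact hc.continuousAt.eventually_mem ((isOpen_axisCone C u v).mem_nhds (by simpa using hb))
  obtain ⟨δ, hδ, hball⟩ := Metric.eventually_nhds_iff.1 ((key (a := a) hb).and (key (a := b) ha))
  have side : ∀ {a b : Fin 2 → ℝ}, wedge a b ≠ 0 →
      (∀ ε : ℝ, |ε| < δ → b + ε • a ∈ axisCone C u v) →
      ∀ w, |wedge w b| < δ * |wedge w a| → w ∈ axisCone C u v := by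
    intro a b hab h w hw
    have hwa : wedge w a ≠ 0 := by
      intro h0
      rw [h0, abs_zero, mul_zero] at hw
      exact absurd hw (abs_nonneg _).not_gt
    have h1 := h (-(wedge w b / wedge w a)) (by
      rw [abs_neg, abs_div]; exact (div_lt_iff₀ (abs_pos.2 hwa)).2 hw)
    have h2 := smul_mem_axisCone (c := -(wedge w a) / wedge a b)
      (div_ne_zero (neg_ne_zero.2 hwa) hab) h1
    convert h2 using 1
    conv_lhs => rw [wedge_expansion hab w]
    rw [smul_add, smul_smul, wedge_comm a w, add_comm]
    congr 2
    field_simp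
  refine ⟨δ, hδ, fun w hw => ?_⟩
  rcases hw with hw | hw
  · exact side hab (fun ε hε => (hball (by simpa using hε)).1) w hw
  · refine side (a := b) (b := a) ?_ (fun ε hε => (hball (by simpa using hε)).2) w hw
    rw [wedge_comm]; exact neg_ne_zero.2 hab

lemma IsAxis.pow_notMem_axisCone {g : SL(2, ℝ)} {l C : ℝ} {u v : Fin 2 → ℝ}
    (H : IsAxis g l u v) (hC : 0 < C) (hl : C ≤ |l|) {m : ℕ} (hm : m ≠ 0) {x : Fin 2 → ℝ}
    (hx : x ∈ axisCone C u v) : vecAct (g ^ m) x ∉ axisCone C u v := by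
  rintro ⟨-, h1, -⟩
  have H' := H.pow hm
  have hlm : C ≤ |l ^ m| := by
    rw [abs_pow]; exact hl.trans (le_self_pow₀ H.one_lt.le hm)
  rw [H'.wedge_left, H'.wedge_right', abs_mul, abs_mul, abs_inv] at h1
  generalize |l ^ m| = L at *
  have hL : 0 < L := by linarith
  have h2 := hx.2.2
  have h3 : L * (L * |wedge x v|) < C * |wedge x u| := by
    have := mul_lt_mul_of_pos_left h1 hL
    field_simp at this ⊢
    linarith
  nlinarith [abs_nonneg (wedge x v), mul_lt_mul_of_pos_left h2 hC,
    mul_le_mul hlm hlm hC.le hL.le, mul_le_mul_of_nonneg_right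
    (mul_le_mul hlm hlm hC.le hL.le) (abs_nonneg (wedge x v))]

lemma IsAxis.zpow_axisForm {g : SL(2, ℝ)} {l : ℝ} {u v : Fin 2 → ℝ}
    (H : IsAxis g l u v) (n : ℤ) (w : Fin 2 → ℝ) :
    axisForm u v (vecAct (g ^ n) w) = axisForm u v w := by
  rcases eq_or_ne n 0 with rfl | hn
  · rw [zpow_zero, vecAct_one]
  obtain ⟨m, rfl | rfl⟩ := n.eq_nat_or_neg
  · rw [zpow_natCast]; exact (H.pow (by simpa using hn)).axisForm_vecAct w
  · have h1 := (H.pow (n := m) (by simpa using hn)).axisForm_vecAct (vecAct (g ^ m)⁻¹ w)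
    rw [vecAct_vecAct_inv] at h1
    rw [_root_.zpow_neg, zpow_natCast, h1]

lemma sl2Act_mk (g : SL(2, ℝ)) {x : Fin 2 → ℝ} (hx : x ≠ 0) :
    sl2Act g (Projectivization.mk ℝ x hx)
      = Projectivization.mk ℝ (vecAct g x) (vecAct_ne_zero g hx) :=
  rfl

lemma sl2Act_mk_eq_self {g : SL(2, ℝ)} {x : Fin 2 → ℝ} (hx : x ≠ 0) {c : ℝ}
    (h : vecAct g x = c • x) :
    sl2Act g (Projectivization.mk ℝ x hx) = Projectivization.mk ℝ x hx := by
  rw [sl2Act_mk, Projectivization.mk_eq_mk_iff']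
  exact ⟨c, h.symm⟩

lemma exists_smul_rep_of_sl2Act_eq_self {g : SL(2, ℝ)} {p : RP1} (h : sl2Act g p = p) :
    ∃ c : ℝ, c • p.rep = vecAct g p.rep := by
  rw [← p.mk_rep, sl2Act_mk, Projectivization.mk_eq_mk_iff'] at h
  simpa only [Projectivization.mk_rep] using h

lemma continuous_projectivization_mk :
    Continuous fun x : {x : Fin 2 → ℝ // x ≠ 0} => (Projectivization.mk ℝ x.1 x.2 : RP1) :=
  continuous_quotient_mk'

open Filter Topology in
lemma tendsto_projectivization_mk {f : ℕ → Fin 2 → ℝ} {x : Fin 2 → ℝ} (hf : ∀ n, f n ≠ 0)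
    (hx : x ≠ 0) (h : Tendsto f atTop (𝓝 x)) :
    Tendsto (fun n => (Projectivization.mk ℝ (f n) (hf n) : RP1)) atTop
      (𝓝 (Projectivization.mk ℝ x hx)) := by
  have h' : Tendsto (fun n => (⟨f n, hf n⟩ : {x : Fin 2 → ℝ // x ≠ 0})) atTop (𝓝 ⟨x, hx⟩) :=
    tendsto_subtype_rng.2 h
  exact (continuous_projectivization_mk.tendsto _).comp h'

lemma axisForm_rep_mk_pos (u v : Fin 2 → ℝ) {x : Fin 2 → ℝ} (hx : x ≠ 0) :
    0 < axisForm u v (Projectivization.mk ℝ x hx).rep ↔ 0 < axisForm u v x := by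
  obtain ⟨c, hc⟩ := Projectivization.exists_smul_eq_mk_rep ℝ x hx
  rw [← hc, Units.smul_def, axisForm_smul]
  exact mul_pos_iff_of_pos_left (pow_two_pos_of_ne_zero c.ne_zero)

lemma isOpen_axisForm_rep_pos (u v : Fin 2 → ℝ) :
    IsOpen {p : RP1 | 0 < axisForm u v p.rep} := by
  have hq : Topology.IsQuotientMap
      fun x : {x : Fin 2 → ℝ // x ≠ 0} => (Projectivization.mk ℝ x.1 x.2 : RP1) :=
    isQuotientMap_quotient_mk'
  rw [← hq.isOpen_preimage]
  have : (fun x : {x : Fin 2 → ℝ // x ≠ 0} => (Projectivization.mk ℝ x.1 x.2 : RP1)) ⁻¹'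
      {p : RP1 | 0 < axisForm u v p.rep} = {x | 0 < axisForm u v x.1} := by
    ext x
    exact axisForm_rep_mk_pos u v x.2
  rw [this]
  exact isOpen_lt continuous_const ((continuous_axisForm u v).comp continuous_subtype_val)

lemma IsAxis.mk_mem_closure {g : SL(2, ℝ)} {l : ℝ} {u v a : Fin 2 → ℝ} (H : IsAxis g l u v)
    (ha : a ≠ 0) (hav : wedge a v ≠ 0) {S : Set RP1}
    (hS : ∀ n : ℕ, Projectivization.mk ℝ (vecAct (g ^ n) a) (vecAct_ne_zero _ ha) ∈ S) :
    Projectivization.mk ℝ u (ne_zero_of_wedge_left H.wedge_ne) ∈ closure S := by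
  have hu := ne_zero_of_wedge_left H.wedge_ne
  have hl : ∀ n : ℕ, l⁻¹ ^ n ≠ 0 := fun n => pow_ne_zero _ (inv_ne_zero H.ne_zero)
  have hc := div_ne_zero hav H.wedge_ne
  have h := tendsto_projectivization_mk
    (fun n => smul_ne_zero (hl n) (vecAct_ne_zero (g ^ n) ha)) (smul_ne_zero hc hu) (H.tendsto a)
  have hmk : Projectivization.mk ℝ _ (smul_ne_zero hc hu) = Projectivization.mk ℝ u hu :=
    (Projectivization.mk_eq_mk_iff' ..).2 ⟨_, rfl⟩
  rw [hmk] at h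
  refine mem_closure_of_tendsto h (Filter.Eventually.of_forall fun n => ?_)
  convert hS n using 1
  exact (Projectivization.mk_eq_mk_iff' ..).2 ⟨_, rfl⟩

/-- Given two axes with the second on the positive side of the first, there is a
non-elementary subgroup all of whose axes lie on the positive side of the first axis, but whose
limit set contains both endpoints of the first axis. -/
lemma exists_subgroup_on_side {Γ : Subgroup SL(2, ℝ)} (hPH : PurelyHyperbolic Γ)
    {g h : SL(2, ℝ)} (hg : g ∈ Γ) (hh : h ∈ Γ) {l k : ℝ} {u v a b : Fin 2 → ℝ}
    (Hg : IsAxis g l u v) (Hh : IsAxis h k a b) (ha : 0 < axisForm u v a)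
    (hb : 0 < axisForm u v b) :
    ∃ Φ ≤ Γ, IsNonElementary Φ ∧
      (∀ w ∈ Φ, w ≠ 1 → ∀ p : RP1, sl2Act w p = p → 0 < axisForm u v p.rep) ∧
      Projectivization.mk ℝ u (ne_zero_of_wedge_left Hg.wedge_ne) ∈ limitSet Φ ∧
      Projectivization.mk ℝ v (ne_zero_of_wedge_right Hg.wedge_ne) ∈ limitSet Φ := by
  obtain ⟨Ca, hCa⟩ := exists_mem_axisCone ha
  obtain ⟨Cb, hCb⟩ := exists_mem_axisCone hb
  obtain ⟨C, hC⟩ : ∃ C, max (max Ca Cb) 0 < C := exists_gt _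
  simp only [max_lt_iff] at hC
  obtain ⟨⟨hCaC, hCbC⟩, hC0⟩ := hC
  obtain ⟨δ, hδ, hJ⟩ := exists_doubleCone_subset Hh.wedge_ne (hCa C hCaC) (hCb C hCbC)
  have large {r : ℝ} (hr : 1 < |r|) (B : ℝ) : ∃ n : ℕ, n ≠ 0 ∧ B < |r ^ n| := by
    obtain ⟨n, hn⟩ := pow_unbounded_of_one_lt B hr
    refine ⟨n + 1, n.succ_ne_zero, hn.trans_le ?_⟩
    rw [abs_pow]
    exact pow_le_pow_right₀ hr.le n.le_succ
  obtain ⟨M, hM, hMC⟩ := large Hg.one_lt C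
  obtain ⟨N, hN, hNδ⟩ := large Hh.one_lt (1 / δ)
  replace hNδ : 1 < δ * |k ^ N| := by rwa [div_lt_iff₀' hδ] at hNδ
  have HG := Hg.pow hM
  have HK := Hh.pow hN
  have hGΓ := pow_mem hg M
  have hKΓ := pow_mem hh N
  generalize g ^ M = G at *
  generalize h ^ N = K at *
  generalize l ^ M = L at *
  generalize k ^ N = κ at *
  clear hM hN
  set c : ℤ → SL(2, ℝ) := fun i => G ^ i * K * (G ^ i)⁻¹ with hc
  set X : ℤ → Set (Fin 2 → ℝ) := fun i => {w | vecAct (G ^ i)⁻¹ w ∈ doubleCone δ a b} with hXdef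
  have hcΓ (i : ℤ) : c i ∈ Γ :=
    mul_mem (mul_mem (zpow_mem hGΓ i) hKΓ) (inv_mem (zpow_mem hGΓ i))
  have hX : ∀ i, ∀ m : ℤ, m ≠ 0 → ∀ x, x ≠ 0 → x ∉ X i → vecAct (c i ^ m) x ∈ X i := by
    intro i m hm x hx hxX
    simp only [hXdef, hc, Set.mem_ofPred_eq, conj_zpow, vecAct_mul, vecAct_inv_vecAct]
    exact HK.zpow_mem_doubleCone hδ hNδ hm (vecAct_ne_zero _ hx) hxX
  have hlt : ∀ i j, i < j → Disjoint (X i) (X j) := by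
    intro i j hij
    refine Set.disjoint_left.2 fun x hi hj => ?_
    obtain ⟨n, hn⟩ := Int.le.dest hij.le
    have hn0 : n ≠ 0 := by rintro rfl; simp at hn; exact hij.ne hn
    refine HG.pow_notMem_axisCone hC0 hMC.le hn0 (hJ hj) ?_
    have : G ^ n * (G ^ j)⁻¹ = (G ^ i)⁻¹ := by
      rw [← hn, _root_.zpow_add, zpow_natCast]; group
    rw [← vecAct_mul, this]
    exact hJ hi
  have hdisj : ∀ i j, i ≠ j → Disjoint (X i) (X j) := fun i j hij =>
    hij.lt_or_gt.elim (hlt i j) fun h => (hlt j i h).symm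
  have hXpos : ∀ i, ∀ x ∈ X i, 0 < axisForm u v x := by
    intro i x hx
    have := (hJ hx).1
    rwa [← _root_.zpow_neg, HG.zpow_axisForm] at this
  have hu := ne_zero_of_wedge_left Hg.wedge_ne
  have huX : ∀ i, u ∉ X i := fun i hi => by
    simpa [axisForm, wedge_self] using hXpos i u hi
  have ha0 := ne_zero_of_wedge_left Hh.wedge_ne
  have hfix : ∀ i : ℤ, Projectivization.mk ℝ (vecAct (G ^ i) a) (vecAct_ne_zero _ ha0) ∈
      {p : RP1 | ∃ w ∈ Subgroup.closure (Set.range c), IsHyperbolic w ∧ sl2Act w p = p} := by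
    intro i
    have H := HK.conj (G ^ i)
    exact ⟨c i, Subgroup.subset_closure ⟨i, rfl⟩, hPH _ (hcΓ i) H.ne_one,
      sl2Act_mk_eq_self _ H.left⟩
  refine ⟨Subgroup.closure (Set.range c), ?_, ?_, ?_, ?_, ?_⟩
  · rw [Subgroup.closure_le]
    rintro _ ⟨i, rfl⟩
    exact hcΓ i
  · exact isNonElementary_of_pingPong hdisj hX zero_ne_one hu huX
  · intro w hw hw1 p hp
    by_contra hneg
    obtain ⟨r, hr⟩ := exists_smul_rep_of_sl2Act_eq_self hp
    obtain ⟨i, hi⟩ := exists_vecAct_mem_of_pingPong hdisj hX hw hw1 p.rep_nonzero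
      fun i hi => hneg (hXpos i _ hi)
    have := hXpos i _ hi
    rw [← hr, axisForm_smul] at this
    exact hneg (pos_of_mul_pos_right this (sq_nonneg r))
  · refine HG.mk_mem_closure ha0 (left_ne_zero_of_mul ha.ne') fun n => ?_
    simpa only [zpow_natCast] using hfix n
  · refine HG.inv.mk_mem_closure ha0 ?_ fun n => ?_
    · rw [wedge_comm]; exact neg_ne_zero.2 (right_ne_zero_of_mul ha.ne')
    · simpa only [_root_.zpow_neg, zpow_natCast, inv_pow] using hfix (-n)

lemma exists_isAxis_axisForm_pos_of_limitSet_eq_univ {Γ : Subgroup SL(2, ℝ)}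
    (hPH : PurelyHyperbolic Γ) (hΛ : limitSet Γ = Set.univ) {g : SL(2, ℝ)} (hg : g ∈ Γ) {l : ℝ}
    {u v : Fin 2 → ℝ} (Hg : IsAxis g l u v) :
    ∃ f ∈ Γ, ∃ k x y, IsAxis f k x y ∧ 0 < axisForm u v x ∧ 0 < axisForm u v y := by
  have hs : 0 < axisForm u v (u + v) := by
    have : axisForm u v (u + v) = wedge u v ^ 2 := by
      simp only [axisForm, wedge, Pi.add_apply]; ring
    rw [this]
    exact pow_two_pos_of_ne_zero Hg.wedge_ne
  have hs0 : u + v ≠ 0 := by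
    intro h; rw [h] at hs; simp [axisForm, wedge] at hs
  have hmem : Projectivization.mk ℝ (u + v) hs0 ∈ limitSet Γ := hΛ ▸ Set.mem_univ _
  obtain ⟨p, hp, h, hh, hyp, hfix⟩ := mem_closure_iff.1 hmem _ (isOpen_axisForm_rep_pos u v)
    ((axisForm_rep_mk_pos u v hs0).2 hs)
  obtain ⟨c, hc⟩ := exists_smul_rep_of_sl2Act_eq_self hfix
  obtain ⟨k, a, b, Hh⟩ := exists_isAxis_of_isHyperbolic hyp
  have h0 : axisForm a b p.rep = 0 :=
    Hh.axisForm_eq_zero (by rw [← hc, wedge_smul_left, wedge_self, mul_zero])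
  have pos {z : Fin 2 → ℝ} (hz : z ≠ 0) (hpz : wedge p.rep z = 0) : 0 < axisForm u v z := by
    obtain ⟨r, hr⟩ := exists_smul_of_wedge_eq_zero hz hpz
    have hp' : 0 < axisForm u v p.rep := hp
    rw [← hr, axisForm_smul] at hp'
    exact pos_of_mul_pos_right hp' (sq_nonneg r)
  rcases mul_eq_zero.1 h0 with hb | ha
  · obtain ⟨f, hf, x, y, H⟩ := exists_isAxis_axisForm_pos hPH hg (inv_mem hh) Hg Hh.inv
      (pos (ne_zero_of_wedge_right Hh.wedge_ne) hb)
    exact ⟨f, hf, l, x, y, H⟩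
  · obtain ⟨f, hf, x, y, H⟩ := exists_isAxis_axisForm_pos hPH hg hh Hg Hh
      (pos (ne_zero_of_wedge_left Hh.wedge_ne) (by rw [wedge_comm, ha, neg_zero]))
    exact ⟨f, hf, l, x, y, H⟩

lemma limitSet_bot : limitSet ⊥ = ∅ := by
  rw [limitSet, closure_empty_iff, Set.eq_empty_iff_forall_notMem]
  rintro p ⟨g, hg, hyp, -⟩
  rw [Subgroup.mem_bot.1 hg, _root_.IsHyperbolic] at hyp
  norm_num [Matrix.trace_fin_two] at hyp

lemma axisForm_rep_nonneg_of_mem_limitSet {Φ : Subgroup SL(2, ℝ)} {u v : Fin 2 → ℝ}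
    (hΦ : ∀ w ∈ Φ, w ≠ 1 → ∀ p : RP1, sl2Act w p = p → 0 < axisForm u v p.rep) {p : RP1}
    (hp : p ∈ limitSet Φ) : 0 ≤ axisForm u v p.rep := by
  by_contra hneg
  obtain ⟨q, hq, w, hw, hyp, hfix⟩ := mem_closure_iff.1 hp _ (isOpen_axisForm_rep_pos u (-v)) (by
    change 0 < axisForm u (-v) p.rep
    rw [axisForm_neg_right]; linarith)
  obtain ⟨_, _, _, H⟩ := exists_isAxis_of_isHyperbolic hyp
  have h1 := hΦ w hw H.ne_one q hfix
  have h2 : 0 < axisForm u (-v) q.rep := hq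
  rw [axisForm_neg_right] at h2
  linarith

/-- **Proposition 3.1.** For every nontrivial finitely generated discrete purely hyperbolic
subgroup `Γ` of `SL(2, ℝ)` with `Λ(Γ) = ℝP¹`, there exist non-elementary subgroups `Φ` and
`Θ` of `Γ` with trivial intersection whose limit sets meet in exactly two points; in
particular `Λ(Φ ∩ Θ) ≠ Λ(Φ) ∩ Λ(Θ)`. -/
theorem exists_nonelementary_trivial_inter_two_point_limitSet_inter
    (Γ : Subgroup SL(2, ℝ)) (hnt : Γ ≠ ⊥) (hfg : Γ.FG) (hdisc : DiscreteTopology Γ)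
    (hPH : PurelyHyperbolic Γ) (hΛ : limitSet Γ = Set.univ) :
    ∃ Φ Θ : Subgroup SL(2, ℝ), Φ ≤ Γ ∧ Θ ≤ Γ ∧
      IsNonElementary Φ ∧ IsNonElementary Θ ∧ Φ ⊓ Θ = ⊥ ∧
      (∃ p q : RP1, p ≠ q ∧ limitSet Φ ∩ limitSet Θ = {p, q}) ∧
      limitSet (Φ ⊓ Θ) ≠ limitSet Φ ∩ limitSet Θ := by
  obtain ⟨g, hg, hg1⟩ := Γ.bot_or_exists_ne_one.resolve_left hnt
  obtain ⟨l, u, v, Hg⟩ := exists_isAxis_of_isHyperbolic (hPH g hg hg1)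
  have hu := ne_zero_of_wedge_left Hg.wedge_ne
  have hv := ne_zero_of_wedge_right Hg.wedge_ne
  obtain ⟨f, hf, k, a, b, Hf, ha, hb⟩ :=
    exists_isAxis_axisForm_pos_of_limitSet_eq_univ hPH hΛ hg Hg
  obtain ⟨f₁, hf₁, k₁, a₁, b₁, Hf₁, ha₁, hb₁⟩ :=
    exists_isAxis_axisForm_pos_of_limitSet_eq_univ hPH hΛ hg Hg.neg_right
  obtain ⟨Φ, hΦΓ, hΦne, hΦ, huΦ, hvΦ⟩ := exists_subgroup_on_side hPH hg hf Hg Hf ha hb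
  obtain ⟨Θ, hΘΓ, hΘne, hΘ, huΘ, hvΘ⟩ :=
    exists_subgroup_on_side hPH hg hf₁ Hg.neg_right Hf₁ ha₁ hb₁
  have hneg : Projectivization.mk ℝ (-v) (neg_ne_zero.2 hv) = Projectivization.mk ℝ v hv :=
    (Projectivization.mk_eq_mk_iff' ..).2 ⟨-1, by simp⟩
  rw [hneg] at hvΘ
  have hbot : Φ ⊓ Θ = ⊥ := by
    refine (Subgroup.eq_bot_iff_forall _).2 fun w hw => ?_
    by_contra hw1
    obtain ⟨_, x, y, H⟩ := exists_isAxis_of_isHyperbolic (hPH w (hΦΓ hw.1) hw1)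
    have hfix := sl2Act_mk_eq_self (ne_zero_of_wedge_left H.wedge_ne) H.left
    have h1 := hΦ w hw.1 hw1 _ hfix
    have h2 := hΘ w hw.2 hw1 _ hfix
    rw [axisForm_neg_right] at h2
    linarith
  have hinter : limitSet Φ ∩ limitSet Θ =
      {Projectivization.mk ℝ u hu, Projectivization.mk ℝ v hv} := by
    refine Set.Subset.antisymm ?_ ?_
    · rintro p ⟨h1, h2⟩
      replace h1 := axisForm_rep_nonneg_of_mem_limitSet hΦ h1
      replace h2 := axisForm_rep_nonneg_of_mem_limitSet hΘ h2
      rw [axisForm_neg_right] at h2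
      have h0 : axisForm u v p.rep = 0 := by linarith
      have eq {z : Fin 2 → ℝ} (hz : z ≠ 0) (hpz : wedge p.rep z = 0) :
          p = Projectivization.mk ℝ z hz := by
        rw [← p.mk_rep, Projectivization.mk_eq_mk_iff']
        exact exists_smul_of_wedge_eq_zero hz hpz
      rcases mul_eq_zero.1 h0 with h | h
      · exact Or.inr (eq hv h)
      · exact Or.inl (eq hu (by rw [wedge_comm, h, neg_zero]))
    · rintro p (rfl | rfl)
      · exact ⟨huΦ, huΘ⟩
      · exact ⟨hvΦ, hvΘ⟩
  refine ⟨Φ, Θ, hΦΓ, hΘΓ, hΦne, hΘne, hbot, ⟨_, _, ?_, hinter⟩, ?_⟩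
  · intro h
    obtain ⟨c, rfl⟩ := (Projectivization.mk_eq_mk_iff' ..).1 h
    exact Hg.wedge_ne (by rw [wedge_smul_left, wedge_self, mul_zero])
  · rw [hbot, limitSet_bot, hinter]
    exact (Set.insert_nonempty _ _).ne_empty.symm

end
end

section
/- There exist a non-elementary discrete purely hyperbolic subgroup Γ of SL(2,ℝ), nontrivial subgroups Φ and Θ of Γ, and a point p ∈ ℝP¹ such that p is a conical limit point of Φ, p is a conical limit point of Θ, p lies in the limit set Λ(Φ ∩ Θ), but p is not a conical limit point of Φ ∩ Θ. -/
open scoped MatrixGroups LinearAlgebra.Projectivization UpperHalfPlane Pointwise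
open Matrix

noncomputable section

/-- The images in `SL(2, ℤ)` of the two free generators. -/
def schottkyGen : Bool → SL(2, ℤ)
  | true => ⟨!![5, 2; 2, 1], by norm_num [Matrix.det_fin_two_of]⟩
  | false => ⟨!![1, 2; 2, 5], by norm_num [Matrix.det_fin_two_of]⟩

/-- The representation of the free group of rank two into `SL(2, ℤ)`. -/
def schottkyHom : FreeGroup Bool →* SL(2, ℤ) := FreeGroup.lift schottkyGen

/-- The square of the Euclidean norm of an integer vector. -/
def normSqInt (v : Fin 2 → ℤ) : ℤ := v 0 ^ 2 + v 1 ^ 2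

lemma normSqInt_nonneg (v : Fin 2 → ℤ) : 0 ≤ normSqInt v := by
  unfold normSqInt; positivity

lemma normSqInt_neg (v : Fin 2 → ℤ) : normSqInt (-v) = normSqInt v := by
  simp [normSqInt]

/-- The action on integer vectors of the element of the free group spelled by one letter. -/
def letterAct (l : Bool × Bool) (v : Fin 2 → ℤ) : Fin 2 → ℤ :=
  (schottkyHom (FreeGroup.mk [l])).1 *ᵥ v

lemma schottkyHom_letter (l : Bool × Bool) :
    (schottkyHom (FreeGroup.mk [l])).1 = match l with
      | (true, true) => !![5, 2; 2, 1]
      | (true, false) => !![1, -2; -2, 5]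
      | (false, true) => !![1, 2; 2, 5]
      | (false, false) => !![5, -2; -2, 1] := by
  rcases l with ⟨_ | _, _ | _⟩
  · have : FreeGroup.mk [(false, false)] = (FreeGroup.of false)⁻¹ := rfl
    rw [this, map_inv, schottkyHom, FreeGroup.lift_apply_of, Matrix.SpecialLinearGroup.coe_inv]
    simp [schottkyGen, Matrix.adjugate_fin_two]
  · exact congrArg Subtype.val (FreeGroup.lift_apply_of : schottkyHom (FreeGroup.of false) = _)
  · have : FreeGroup.mk [(true, false)] = (FreeGroup.of true)⁻¹ := rfl
    rw [this, map_inv, schottkyHom, FreeGroup.lift_apply_of, Matrix.SpecialLinearGroup.coe_inv]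
    simp [schottkyGen, Matrix.adjugate_fin_two]
  · exact congrArg Subtype.val (FreeGroup.lift_apply_of : schottkyHom (FreeGroup.of true) = _)

lemma normSqInt_letterAct (l : Bool × Bool) (v : Fin 2 → ℤ) :
    normSqInt (letterAct l v) = match l with
      | (true, true) => (5 * v 0 + 2 * v 1) ^ 2 + (2 * v 0 + v 1) ^ 2
      | (true, false) => (v 0 - 2 * v 1) ^ 2 + (5 * v 1 - 2 * v 0) ^ 2
      | (false, true) => (v 0 + 2 * v 1) ^ 2 + (2 * v 0 + 5 * v 1) ^ 2
      | (false, false) => (5 * v 0 - 2 * v 1) ^ 2 + (v 1 - 2 * v 0) ^ 2 := by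
  rw [letterAct, schottkyHom_letter]
  rcases l with ⟨_ | _, _ | _⟩ <;>
    simp [normSqInt, Matrix.mulVec, dotProduct, Fin.sum_univ_two] <;> ring

/-- Two distinct letters do not both fail to lengthen a nonzero vector: the sides of the
Dirichlet domain are pairwise disjoint. -/
lemma not_both_shrink {l l' : Bool × Bool} (h : l ≠ l') {v : Fin 2 → ℤ} (hv : v ≠ 0)
    (h1 : normSqInt (letterAct l v) ≤ normSqInt v) :
    normSqInt v < normSqInt (letterAct l' v) := by
  by_contra! h2
  rw [normSqInt_letterAct] at h1 h2
  have h3 : v 0 = 0 ∧ v 1 = 0 := by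
    unfold normSqInt at h1 h2
    constructor <;> rcases l with ⟨_ | _, _ | _⟩ <;> rcases l' with ⟨_ | _, _ | _⟩ <;>
      first
      | exact absurd rfl h
      | (simp only at h1 h2
         rw [← sq_eq_zero_iff]
         nlinarith [sq_nonneg (v 0), sq_nonneg (v 1), sq_nonneg (v 0 + v 1),
           sq_nonneg (v 0 - v 1)])
  exact hv (by ext i; fin_cases i; exacts [h3.1, h3.2])

lemma letterAct_cancel (a b : Bool) (v : Fin 2 → ℤ) :
    letterAct (a, !b) (letterAct (a, b) v) = v := by
  have h : FreeGroup.mk [(a, !b)] * FreeGroup.mk [(a, b)] = 1 := by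
    cases b
    · exact mul_inv_cancel (FreeGroup.of a)
    · exact inv_mul_cancel (FreeGroup.of a)
  unfold letterAct
  rw [Matrix.mulVec_mulVec, ← Matrix.SpecialLinearGroup.coe_mul, ← map_mul, h, map_one,
    Matrix.SpecialLinearGroup.coe_one, Matrix.one_mulVec]

lemma schottkyHom_mk_cons (l : Bool × Bool) (L : List (Bool × Bool)) (v : Fin 2 → ℤ) :
    (schottkyHom (FreeGroup.mk (l :: L))).1 *ᵥ v =
      letterAct l ((schottkyHom (FreeGroup.mk L)).1 *ᵥ v) := by
  unfold letterAct
  rw [Matrix.mulVec_mulVec, ← Matrix.SpecialLinearGroup.coe_mul, ← map_mul, FreeGroup.mul_mk]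
  rfl

lemma mulVec_ne_zero_int (g : SL(2, ℤ)) {v : Fin 2 → ℤ} (hv : v ≠ 0) : g.1 *ᵥ v ≠ 0 := by
  intro h
  apply hv
  have : (g⁻¹).1 *ᵥ (g.1 *ᵥ v) = v := by
    rw [Matrix.mulVec_mulVec, ← Matrix.SpecialLinearGroup.coe_mul]; simp
  rw [← this, h, Matrix.mulVec_zero]

/-- Along a reduced word, a nonzero vector that no letter shortens gets longer and longer. -/
lemma normSqInt_cons {v : Fin 2 → ℤ} (hv : v ≠ 0)
    (hmin : ∀ l, normSqInt v ≤ normSqInt (letterAct l v)) (L : List (Bool × Bool))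
    (l : Bool × Bool) (hL : FreeGroup.IsReduced (l :: L)) :
    normSqInt ((schottkyHom (FreeGroup.mk L)).1 *ᵥ v) ≤
        normSqInt ((schottkyHom (FreeGroup.mk (l :: L))).1 *ᵥ v) ∧
      (L ≠ [] → normSqInt ((schottkyHom (FreeGroup.mk L)).1 *ᵥ v) <
        normSqInt ((schottkyHom (FreeGroup.mk (l :: L))).1 *ᵥ v)) := by
  induction L generalizing l with
  | nil =>
    refine ⟨?_, fun h => absurd rfl h⟩
    have : (schottkyHom (FreeGroup.mk [])).1 *ᵥ v = v := by
      rw [← FreeGroup.one_eq_mk, map_one, Matrix.SpecialLinearGroup.coe_one, Matrix.one_mulVec]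
    rw [schottkyHom_mk_cons, this]
    exact hmin l
  | cons m L ih =>
    rw [FreeGroup.isReduced_cons_cons] at hL
    have h1 := (ih m hL.2).1
    have key := not_both_shrink (l := (m.1, !m.2)) (l' := l)
      (v := (schottkyHom (FreeGroup.mk (m :: L))).1 *ᵥ v)
      (by rintro rfl; simpa using hL.1) (mulVec_ne_zero_int _ hv)
      (by rwa [schottkyHom_mk_cons m, letterAct_cancel m.1 m.2, ← schottkyHom_mk_cons m])
    rw [← schottkyHom_mk_cons] at key
    exact ⟨key.le, fun _ => key⟩

lemma normSqInt_le_word {v : Fin 2 → ℤ} (hv : v ≠ 0)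
    (hmin : ∀ l, normSqInt v ≤ normSqInt (letterAct l v)) (L : List (Bool × Bool))
    (hL : FreeGroup.IsReduced L) :
    normSqInt v ≤ normSqInt ((schottkyHom (FreeGroup.mk L)).1 *ᵥ v) := by
  induction L with
  | nil => rw [← FreeGroup.one_eq_mk, map_one, Matrix.SpecialLinearGroup.coe_one,
      Matrix.one_mulVec]
  | cons l L ih =>
    exact (ih (hL.infix (List.infix_cons (List.infix_refl _)))).trans
      (normSqInt_cons hv hmin L l hL).1

lemma ne_of_minimal {v : Fin 2 → ℤ} (hv : v ≠ 0)
    (hmin : ∀ l, normSqInt v ≤ normSqInt (letterAct l v)) {u : FreeGroup Bool} (hu : u ≠ 1) :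
    (schottkyHom u).1 *ᵥ v ≠ v ∧ (schottkyHom u).1 *ᵥ v ≠ -v := by
  have hred := FreeGroup.isReduced_toWord (x := u)
  have hmk := FreeGroup.mk_toWord (x := u)
  rcases hw : u.toWord with _ | ⟨l, _ | ⟨m, L⟩⟩
  · exact absurd (FreeGroup.toWord_eq_nil_iff.1 hw) hu
  · rw [hw] at hmk
    rw [← hmk]
    have inv (ε : ℤ) (hε : ε * ε = 1) (h : letterAct l v = ε • v) :
        letterAct (l.1, !l.2) v = ε • v := by
      have h1 := letterAct_cancel l.1 l.2 v
      rw [Prod.mk.eta, h, letterAct, Matrix.mulVec_smul, ← letterAct] at h1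
      rw [← h1, smul_smul, hε, one_smul, h1]
    have hne : l ≠ (l.1, !l.2) := by
      rcases l with ⟨_ | _, _ | _⟩ <;> decide
    constructor <;> intro h
    · have h' := inv 1 rfl (by simpa [letterAct] using h)
      have := not_both_shrink hne hv (by rw [letterAct, h])
      rw [h', one_smul] at this
      exact this.false
    · have h' := inv (-1) rfl (by simpa [letterAct] using h)
      have := not_both_shrink hne hv (by rw [letterAct, h, normSqInt_neg])
      rw [h', neg_smul, one_smul, normSqInt_neg] at this
      exact this.false
  · rw [hw] at hmk hred
    have h1 := normSqInt_le_word hv hmin (m :: L)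
      (hred.infix (List.infix_cons (List.infix_refl _)))
    have h2 := (normSqInt_cons hv hmin (m :: L) l hred).2 (by simp)
    rw [hmk] at h2
    constructor <;> intro h <;> rw [h] at h2
    · exact (h1.trans_lt h2).false
    · rw [normSqInt_neg] at h2
      exact (h1.trans_lt h2).false

/-- No nontrivial element of the Schottky group fixes a nonzero integer vector up to sign. -/
lemma schottkyHom_mulVec_ne {v : Fin 2 → ℤ} (hv : v ≠ 0) {u : FreeGroup Bool} (hu : u ≠ 1) :
    (schottkyHom u).1 *ᵥ v ≠ v ∧ (schottkyHom u).1 *ᵥ v ≠ -v := by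
  induction hn : (normSqInt v).toNat using Nat.strong_induction_on generalizing v u with
  | _ n ih =>
  by_cases hmin : ∀ l, normSqInt v ≤ normSqInt (letterAct l v)
  · exact ne_of_minimal hv hmin hu
  push Not at hmin
  obtain ⟨l, hl⟩ := hmin
  set x : FreeGroup Bool := FreeGroup.mk [l] with hx
  have := ih _ (by have := normSqInt_nonneg (letterAct l v); omega) (v := letterAct l v)
    (mulVec_ne_zero_int _ hv) (u := x * u * x⁻¹) (by simpa using hu) rfl
  have key : (schottkyHom (x * u * x⁻¹)).1 *ᵥ letterAct l v =
      (schottkyHom x).1 *ᵥ ((schottkyHom u).1 *ᵥ v) := by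
    rw [letterAct, ← hx]
    simp only [Matrix.mulVec_mulVec, ← Matrix.SpecialLinearGroup.coe_mul, ← map_mul]
    simp
  rw [key] at this
  constructor <;> intro h
  · exact this.1 (by rw [h]; rfl)
  · exact this.2 (by rw [h, Matrix.mulVec_neg]; rfl)

lemma schottkyHom_injective : Function.Injective schottkyHom := by
  rw [injective_iff_map_eq_one]
  intro u hu
  by_contra h
  apply (schottkyHom_mulVec_ne (v := ![1, 0]) (by decide) h).1
  rw [hu, Matrix.SpecialLinearGroup.coe_one, Matrix.one_mulVec]

lemma exists_mulVec_eq_of_det (M : Matrix (Fin 2) (Fin 2) ℤ) (ε : ℤ)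
    (h : (M - Matrix.diagonal fun _ => ε).det = 0) : ∃ v ≠ 0, M *ᵥ v = ε • v := by
  obtain ⟨v, hv, h⟩ := Matrix.exists_mulVec_eq_zero_iff.2 h
  refine ⟨v, hv, ?_⟩
  rw [Matrix.sub_mulVec, sub_eq_zero] at h
  rw [h]
  ext i
  simp [Matrix.mulVec_diagonal]

/-- Nontrivial elements of the Schottky group have trace of absolute value greater than two. -/
lemma two_lt_abs_trace_schottkyHom {u : FreeGroup Bool} (hu : u ≠ 1) :
    2 < |(schottkyHom u).1.trace| := by
  by_contra! hle
  have hpow (n : ℕ) (hn : n ≠ 0) : u ^ n ≠ 1 := by simpa [hn] using hu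
  have e1 : (![1, 0] : Fin 2 → ℤ) ≠ 0 := by decide
  have hdet := (schottkyHom u).2
  set M := (schottkyHom u).1 with hM
  have hMpow (n : ℕ) : (schottkyHom (u ^ n)).1 = M ^ n := by
    rw [map_pow, Matrix.SpecialLinearGroup.coe_pow]
  rw [Matrix.det_fin_two] at hdet
  rw [Matrix.trace_fin_two] at hle
  obtain ⟨h1, h2⟩ := abs_le.1 hle
  have hsq (t : ℤ) (ht : M 0 0 + M 1 1 = t) : M ^ 2 = t • M - 1 := by
    ext i j
    fin_cases i <;> fin_cases j <;>
      simp [-zsmul_eq_mul, pow_two, Matrix.mul_apply, Fin.sum_univ_two, ← ht] <;> linarith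
  have hcases : M 0 0 + M 1 1 = 2 ∨ M 0 0 + M 1 1 = -2 ∨ M 0 0 + M 1 1 = 0 ∨
      M 0 0 + M 1 1 = 1 ∨ M 0 0 + M 1 1 = -1 := by omega
  rcases hcases with h | h | h | h | h
  · obtain ⟨v, hv, hMv⟩ := exists_mulVec_eq_of_det M 1 (by
      simp [Matrix.det_fin_two]; linarith)
    exact (schottkyHom_mulVec_ne hv hu).1 (by rw [← hM, hMv, one_smul])
  · obtain ⟨v, hv, hMv⟩ := exists_mulVec_eq_of_det M (-1) (by
      simp [Matrix.det_fin_two]; linarith)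
    exact (schottkyHom_mulVec_ne hv hu).2 (by rw [← hM, hMv, neg_smul, one_smul])
  · apply (schottkyHom_mulVec_ne e1 (hpow 2 (by norm_num))).2
    rw [hMpow, hsq _ h]
    simp [Matrix.neg_mulVec]
  · apply (schottkyHom_mulVec_ne e1 (hpow 3 (by norm_num))).2
    have : M ^ 3 = -1 := by
      rw [pow_succ, hsq _ h, one_smul, sub_mul, ← pow_two, hsq _ h]; simp
    rw [hMpow, this]
    simp [Matrix.neg_mulVec]
  · apply (schottkyHom_mulVec_ne e1 (hpow 3 (by norm_num))).1
    have : M ^ 3 = 1 := by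
      rw [pow_succ, hsq _ h, neg_smul, one_smul, sub_mul, neg_mul, ← pow_two, hsq _ h]; simp
    rw [hMpow, this]
    simp

/-- The representation of the free group of rank two into `SL(2, ℝ)`. -/
def schottkyReal : FreeGroup Bool →* SL(2, ℝ) :=
  (Matrix.SpecialLinearGroup.map (Int.castRingHom ℝ)).comp schottkyHom

lemma schottkyReal_apply (u : FreeGroup Bool) (i j : Fin 2) :
    (schottkyReal u).1 i j = ((schottkyHom u).1 i j : ℝ) := rfl

lemma schottkyReal_injective : Function.Injective schottkyReal := by
  intro u v h
  apply schottkyHom_injective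
  apply Matrix.SpecialLinearGroup.ext
  intro i j
  have : (schottkyReal u).1 i j = (schottkyReal v).1 i j := by rw [h]
  rw [schottkyReal_apply, schottkyReal_apply] at this
  exact_mod_cast this

lemma isHyperbolic_schottkyReal {u : FreeGroup Bool} (hu : u ≠ 1) :
    IsHyperbolic (schottkyReal u) := by
  have h := two_lt_abs_trace_schottkyHom hu
  rw [Matrix.trace_fin_two] at h
  unfold _root_.IsHyperbolic
  rw [Matrix.trace_fin_two, schottkyReal_apply, schottkyReal_apply]
  exact_mod_cast h

lemma purelyHyperbolic_schottky : PurelyHyperbolic schottkyReal.range := by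
  rintro _ ⟨u, rfl⟩ hg
  exact isHyperbolic_schottkyReal (by rintro rfl; exact hg (map_one _))

lemma discreteTopology_schottky : DiscreteTopology schottkyReal.range := by
  have h1 : DiscreteTopology
      (Matrix.SpecialLinearGroup.map (n := Fin 2) (Int.castRingHom ℝ)).range :=
    Matrix.SpecialLinearGroup.discreteSpecialLinearGroupIntRangeSL
  refine DiscreteTopology.of_subset (s := (Matrix.SpecialLinearGroup.map (n := Fin 2)
    (Int.castRingHom ℝ)).range) h1 ?_
  rintro _ ⟨u, rfl⟩
  exact ⟨schottkyHom u, rfl⟩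

lemma pow_of_mul_pow_of_ne {n m : ℕ} (hn : n ≠ 0) (hm : m ≠ 0) :
    FreeGroup.of true ^ n * FreeGroup.of false ^ m ≠
      FreeGroup.of false ^ m * FreeGroup.of true ^ n := by
  intro h
  have hred (x y : Bool) (k l : ℕ) : (FreeGroup.of x ^ k * FreeGroup.of y ^ l).toWord =
      List.replicate k (x, true) ++ List.replicate l (y, true) := by
    rw [FreeGroup.toWord_mul, FreeGroup.toWord_of_pow, FreeGroup.toWord_of_pow]
    apply FreeGroup.IsReduced.reduce_eq
    apply List.Pairwise.isChain
    rw [List.pairwise_iff_forall_sublist]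
    intro a b hab _
    have key : ∀ c ∈ List.replicate k (x, true) ++ List.replicate l (y, true), c.2 = true := by
      intro c hc
      rcases List.mem_append.1 hc with hc | hc <;> rw [(List.mem_replicate.1 hc).2]
    rw [key a (hab.subset (by simp)), key b (hab.subset (by simp))]
  have h' := congrArg FreeGroup.toWord h
  rw [hred, hred] at h'
  obtain ⟨n, rfl⟩ := Nat.exists_eq_succ_of_ne_zero hn
  obtain ⟨m, rfl⟩ := Nat.exists_eq_succ_of_ne_zero hm
  simp [List.replicate_succ] at h'

lemma isNonElementary_schottky : IsNonElementary schottkyReal.range := by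
  rintro ⟨H, hfin, hcomm⟩
  have key (x : Bool) : ∃ n : ℕ, n ≠ 0 ∧
      (⟨schottkyReal (FreeGroup.of x ^ n), _, rfl⟩ : schottkyReal.range) ∈ H := by
    obtain ⟨n, hn, -, hmem⟩ := Subgroup.exists_pow_mem_of_index_ne_zero hfin.index_ne_zero
      (⟨schottkyReal (FreeGroup.of x), _, rfl⟩ : schottkyReal.range)
    refine ⟨n, hn.ne', ?_⟩
    convert hmem using 1
    exact Subtype.ext (map_pow _ _ _)
  obtain ⟨n, hn, hn'⟩ := key true
  obtain ⟨m, hm, hm'⟩ := key false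
  have := congrArg Subtype.val (hcomm _ hn' _ hm')
  simp only [Subgroup.coe_mul, ← map_mul] at this
  exact pow_of_mul_pow_of_ne hn hm (schottkyReal_injective this)

/-- The homomorphism to `ℤ` sending the two free generators to `a` and `b`. -/
def weight (a b : ℤ) : FreeGroup Bool →* Multiplicative ℤ :=
  FreeGroup.lift fun x => Multiplicative.ofAdd (bif x then a else b)

lemma weight_of (a b : ℤ) (x : Bool) :
    weight a b (FreeGroup.of x) = Multiplicative.ofAdd (bif x then a else b) := by
  simp [weight]

lemma weight_one_one (u : FreeGroup Bool) :
    weight 1 1 u = (weight 1 (-2) u * weight (-2) 1 u)⁻¹ := by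
  have : weight 1 1 = (weight 1 (-2) * weight (-2) 1)⁻¹ := by
    ext x
    cases x <;> simp [weight]
  rw [this]; rfl

/-- The infinite positive word whose blocks of equal letters have lengths `1, 2, 4, 8, …`. -/
def blockWord : ℕ → FreeGroup Bool
  | 0 => 1
  | n + 1 => blockWord n * FreeGroup.of (decide (Even (Nat.log 2 (n + 1))))

lemma weight_one_one_blockWord (n : ℕ) :
    weight 1 1 (blockWord n) = Multiplicative.ofAdd (n : ℤ) := by
  induction n with
  | zero => simp [blockWord]
  | succ n ih => simp [blockWord, ih, weight_of, ofAdd_add]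

lemma blockWord_injective : Function.Injective blockWord := by
  intro n m h
  have := congrArg (weight 1 1) h
  simpa [weight_one_one_blockWord] using this

lemma blockWord_block (k l : ℕ) (hl : l ≤ 2 ^ k) :
    blockWord (2 ^ k - 1 + l) =
      blockWord (2 ^ k - 1) * FreeGroup.of (decide (Even k)) ^ l := by
  induction l with
  | zero => simp
  | succ l ih =>
    have : Nat.log 2 (2 ^ k - 1 + l + 1) = k := by
      have := Nat.one_le_two_pow (n := k)
      rw [Nat.log_eq_iff (by right; omega), pow_succ]
      omega
    rw [← add_assoc, blockWord, this, ih (by omega), pow_succ, mul_assoc]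

lemma weight_blockWord (a b : ℤ) (k : ℕ) :
    weight a b (blockWord (2 ^ (k + 1) - 1)) = weight a b (blockWord (2 ^ k - 1)) *
      Multiplicative.ofAdd ((2 : ℤ) ^ k * bif decide (Even k) then a else b) := by
  have h1 : 2 ^ (k + 1) - 1 = 2 ^ k - 1 + 2 ^ k := by
    have := Nat.one_le_two_pow (n := k)
    rw [pow_succ]; omega
  rw [h1, blockWord_block _ _ le_rfl, map_mul, map_pow, weight_of, ← ofAdd_nsmul]
  simp

lemma weight_blockWord_even (m : ℕ) : weight (-2) 1 (blockWord (2 ^ (2 * m) - 1)) = 1 := by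
  induction m with
  | zero => simp [blockWord]
  | succ m ih =>
    rw [show 2 * (m + 1) = 2 * m + 1 + 1 by ring, weight_blockWord, weight_blockWord, ih, one_mul,
      ← ofAdd_add, ofAdd_eq_one]
    simp [pow_succ]

lemma weight_blockWord_odd (m : ℕ) :
    weight 1 (-2) (blockWord (2 ^ (2 * m + 1) - 1)) = Multiplicative.ofAdd 1 := by
  induction m with
  | zero => simp [blockWord, weight_of]
  | succ m ih =>
    rw [show 2 * (m + 1) + 1 = 2 * m + 1 + 1 + 1 by ring, weight_blockWord, weight_blockWord, ih,
      mul_assoc, ← ofAdd_add]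
    simp [Nat.even_add_one, pow_succ]

/-- A sequence of partial products of matrices with all entries in `[1, 5]`. -/
structure IsPositiveProduct (w : ℕ → SL(2, ℝ)) : Prop where
  zero : w 0 = 1
  succ : ∀ n, ∃ g : SL(2, ℝ), w (n + 1) = w n * g ∧ ∀ i j, 1 ≤ g.1 i j ∧ g.1 i j ≤ 5

namespace IsPositiveProduct

variable {w : ℕ → SL(2, ℝ)}

lemma succ_entries (hw : IsPositiveProduct w) (n : ℕ) : ∃ α β γ δ : ℝ,
    (1 ≤ α ∧ α ≤ 5) ∧ (1 ≤ β ∧ β ≤ 5) ∧ (1 ≤ γ ∧ γ ≤ 5) ∧ (1 ≤ δ ∧ δ ≤ 5) ∧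
    α * δ - β * γ = 1 ∧
    (w (n + 1)).1 0 0 = (w n).1 0 0 * α + (w n).1 0 1 * γ ∧
    (w (n + 1)).1 0 1 = (w n).1 0 0 * β + (w n).1 0 1 * δ ∧
    (w (n + 1)).1 1 0 = (w n).1 1 0 * α + (w n).1 1 1 * γ ∧
    (w (n + 1)).1 1 1 = (w n).1 1 0 * β + (w n).1 1 1 * δ := by
  obtain ⟨g, hg, hb⟩ := hw.succ n
  refine ⟨_, _, _, _, hb 0 0, hb 0 1, hb 1 0, hb 1 1, ?_, ?_⟩
  · rw [← Matrix.det_fin_two]; exact g.2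
  · rw [hg, Matrix.SpecialLinearGroup.coe_mul]
    simp [Matrix.mul_apply, Fin.sum_univ_two]

lemma det_eq (n : ℕ) :
    (w n).1 0 0 * (w n).1 1 1 - (w n).1 0 1 * (w n).1 1 0 = 1 := by
  rw [← Matrix.det_fin_two]; exact (w n).2

lemma entries_nonneg (hw : IsPositiveProduct w) (n : ℕ) :
    0 ≤ (w n).1 0 0 ∧ 0 ≤ (w n).1 0 1 ∧ (n : ℝ) ≤ (w n).1 1 0 ∧ 1 ≤ (w n).1 1 1 := by
  induction n with
  | zero => simp [hw.zero]
  | succ n ih =>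
    obtain ⟨α, β, γ, δ, hα, hβ, hγ, hδ, -, h1, h2, h3, h4⟩ := hw.succ_entries n
    obtain ⟨i1, i2, i3, i4⟩ := ih
    have hn : (0 : ℝ) ≤ n := n.cast_nonneg
    rw [h1, h2, h3, h4]
    push_cast
    refine ⟨?_, ?_, ?_, ?_⟩ <;> nlinarith

lemma row_ratio (hw : IsPositiveProduct w) {n : ℕ} (hn : 1 ≤ n) :
    (w n).1 1 0 ≤ 5 * (w n).1 1 1 ∧ (w n).1 1 1 ≤ 5 * (w n).1 1 0 := by
  obtain ⟨n, rfl⟩ := Nat.exists_eq_add_of_le' hn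
  obtain ⟨α, β, γ, δ, hα, hβ, hγ, hδ, -, -, -, h3, h4⟩ := hw.succ_entries n
  obtain ⟨-, -, i3, i4⟩ := hw.entries_nonneg n
  have hn : (0 : ℝ) ≤ n := n.cast_nonneg
  rw [h3, h4]
  constructor <;> nlinarith

lemma succ_le (hw : IsPositiveProduct w) {n : ℕ} (hn : 1 ≤ n) :
    (w (n + 1)).1 1 0 ≤ 30 * (w n).1 1 0 := by
  obtain ⟨α, β, γ, δ, hα, hβ, hγ, hδ, -, -, -, h3, h4⟩ := hw.succ_entries n
  obtain ⟨-, -, i3, i4⟩ := hw.entries_nonneg n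
  have h := (hw.row_ratio hn).2
  have hn : (0 : ℝ) ≤ n := n.cast_nonneg
  rw [h3]
  nlinarith

lemma one_le_five (hw : IsPositiveProduct w) : (w 1).1 1 0 ≤ 5 := by
  obtain ⟨α, β, γ, δ, hα, hβ, hγ, hδ, -, -, -, h3, -⟩ := hw.succ_entries 0
  simp only [hw.zero, zero_add] at h3
  rw [h3]
  simpa using hγ.2

lemma nested (hw : IsPositiveProduct w) (m k : ℕ) :
    (w (m + k)).1 0 0 * (w m).1 1 0 ≤ (w m).1 0 0 * (w (m + k)).1 1 0 ∧
    (w (m + k)).1 0 1 * (w m).1 1 0 ≤ (w m).1 0 0 * (w (m + k)).1 1 1 ∧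
    (w m).1 0 1 * (w (m + k)).1 1 1 ≤ (w (m + k)).1 0 1 * (w m).1 1 1 ∧
    (w m).1 0 1 * (w (m + k)).1 1 0 ≤ (w (m + k)).1 0 0 * (w m).1 1 1 := by
  induction k with
  | zero =>
    have := det_eq (w := w) m
    refine ⟨?_, ?_, ?_, ?_⟩ <;> simp only [add_zero] <;> linarith
  | succ k ih =>
    obtain ⟨α, β, γ, δ, hα, hβ, hγ, hδ, -, h1, h2, h3, h4⟩ := hw.succ_entries (m + k)
    obtain ⟨i1, i2, i3, i4⟩ := ih
    rw [← add_assoc, h1, h2, h3, h4]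
    refine ⟨?_, ?_, ?_, ?_⟩ <;> nlinarith

/-- The limit of a sequence of positive products. -/
lemma exists_limit (hw : IsPositiveProduct w) : ∃ p : ℝ, ∀ n,
    (w n).1 0 1 ≤ p * (w n).1 1 1 ∧ p * (w n).1 1 0 ≤ (w n).1 0 0 := by
  have hd (n : ℕ) : 0 < (w n).1 1 1 := lt_of_lt_of_le one_pos (hw.entries_nonneg n).2.2.2
  have hc (n : ℕ) (hn : 1 ≤ n) : 0 < (w n).1 1 0 :=
    lt_of_lt_of_le (by exact_mod_cast hn) (hw.entries_nonneg n).2.2.1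
  have key (n m : ℕ) (hm : 1 ≤ m) :
      (w n).1 0 1 / (w n).1 1 1 ≤ (w m).1 0 0 / (w m).1 1 0 := by
    rw [div_le_div_iff₀ (hd n) (hc m hm)]
    rcases le_total m n with h | h
    · obtain ⟨k, rfl⟩ := Nat.exists_eq_add_of_le h
      exact (hw.nested m k).2.1
    · obtain ⟨k, rfl⟩ := Nat.exists_eq_add_of_le h
      exact (hw.nested n k).2.2.2
  refine ⟨⨆ n, (w n).1 0 1 / (w n).1 1 1, fun n => ⟨?_, ?_⟩⟩
  · rw [← div_le_iff₀ (hd n)]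
    refine le_ciSup (f := fun n => (w n).1 0 1 / (w n).1 1 1) ⟨(w 1).1 0 0 / (w 1).1 1 0, ?_⟩ n
    rintro _ ⟨k, rfl⟩
    exact key k 1 le_rfl
  · rcases Nat.eq_zero_or_pos n with rfl | hn
    · simp [hw.zero]
    · rw [← le_div_iff₀ (hc n hn)]
      exact ciSup_le fun k => key k n hn

end IsPositiveProduct

/-- A compact box in the upper half-plane. -/
def hBox : Set ℍ := {z | |z.re| ≤ 5 ∧ 1 / (900 * (25 + 900 ^ 2)) ≤ z.im ∧ z.im ≤ 900}

lemma isCompact_hBox : IsCompact hBox := by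
  rw [UpperHalfPlane.isEmbedding_coe.isCompact_iff]
  have : ((↑) : ℍ → ℂ) '' hBox =
      Set.Icc (-5) 5 ×ℂ Set.Icc (1 / (900 * (25 + 900 ^ 2))) 900 := by
    ext z
    simp only [Set.mem_image, Complex.mem_reProdIm, hBox, Set.mem_ofPred_eq, Set.mem_Icc, abs_le]
    constructor
    · rintro ⟨z, hz, rfl⟩
      exact hz
    · intro hz
      exact ⟨⟨z, lt_of_lt_of_le (by norm_num) hz.2.1⟩, hz, rfl⟩
  rw [this]
  exact isCompact_Icc.reProdIm isCompact_Icc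

lemma coe_inv_smul (g : SL(2, ℝ)) (z : ℍ) :
    ((g⁻¹ • z : ℍ) : ℂ) = ((g.1 1 1 : ℂ) * z - g.1 0 1) / (-(g.1 1 0 : ℂ) * z + g.1 0 0) := by
  rw [UpperHalfPlane.coe_specialLinearGroup_apply, Matrix.SpecialLinearGroup.SL2_inv_expl]
  simp [sub_eq_add_neg]

namespace IsPositiveProduct

variable {w : ℕ → SL(2, ℝ)} {p : ℝ}

lemma inv_smul_mem_hBox (hw : IsPositiveProduct w)
    (hp : ∀ n, (w n).1 0 1 ≤ p * (w n).1 1 1 ∧ p * (w n).1 1 0 ≤ (w n).1 0 0)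
    {n : ℕ} (hn : 1 ≤ n) {z : ℍ} (hz : z.re = p)
    (h1 : 1 / 900 ≤ (w n).1 1 0 ^ 2 * z.im) (h2 : (w n).1 1 0 ^ 2 * z.im ≤ 900) :
    (w n)⁻¹ • z ∈ hBox := by
  obtain ⟨r1, r2⟩ := hw.row_ratio hn
  obtain ⟨-, -, i3, i4⟩ := hw.entries_nonneg n
  obtain ⟨p1, p2⟩ := hp n
  have hdet := det_eq (w := w) n
  have ht := z.im_pos
  have hfe : (w n).1 1 1 * p - (w n).1 0 1 ≤ 5 * ((w n).1 0 0 - (w n).1 1 0 * p) := by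
    obtain ⟨α, β, γ, δ, hα, hβ, hγ, hδ, hg, g1, g2, g3, g4⟩ := hw.succ_entries n
    obtain ⟨q1, q2⟩ := hp (n + 1)
    have hf : (w n).1 1 1 * p - (w n).1 0 1 =
        α * (p * (w (n + 1)).1 1 1 - (w (n + 1)).1 0 1) +
          β * ((w (n + 1)).1 0 0 - p * (w (n + 1)).1 1 0) := by
      rw [g1, g2, g3, g4]
      linear_combination (-((w n).1 1 1 * p - (w n).1 0 1)) * hg
    have he : (w n).1 0 0 - (w n).1 1 0 * p =
        γ * (p * (w (n + 1)).1 1 1 - (w (n + 1)).1 0 1) +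
          δ * ((w (n + 1)).1 0 0 - p * (w (n + 1)).1 1 0) := by
      rw [g1, g2, g3, g4]
      linear_combination (-((w n).1 0 0 - (w n).1 1 0 * p)) * hg
    rw [hf, he]
    nlinarith
  have hcoe := coe_inv_smul (w n) z
  have hzc : (z : ℂ) = ⟨p, z.im⟩ := Complex.ext hz rfl
  rw [hzc] at hcoe
  generalize (w n).1 0 0 = a at *
  generalize (w n).1 0 1 = b at *
  generalize (w n).1 1 0 = c at *
  generalize (w n).1 1 1 = d at *
  generalize z.im = t at *
  set z' := (w n)⁻¹ • z
  have hc : 0 < c := by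
    have : (1 : ℝ) ≤ n := by exact_mod_cast hn
    linarith
  obtain ⟨e, he⟩ : ∃ e, e = a - c * p := ⟨_, rfl⟩
  obtain ⟨f, hf⟩ : ∃ f, f = d * p - b := ⟨_, rfl⟩
  rw [← he, ← hf] at hfe
  have he0 : 0 ≤ e := by linarith
  have hf0 : 0 ≤ f := by linarith
  have hD : 0 < e ^ 2 + (c * t) ^ 2 := by positivity
  have hcf : c * f + d * e = 1 := by rw [he, hf]; linarith
  have hre : z'.re = (f * e - d * c * t ^ 2) / (e ^ 2 + (c * t) ^ 2) := by
    have := congrArg Complex.re hcoe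
    rw [UpperHalfPlane.coe_re] at this
    rw [this, Complex.div_re]
    simp [Complex.normSq_apply]
    rw [← add_div]
    congr 1
    · rw [he, hf]; ring
    · rw [he]; ring
  have him : z'.im = t / (e ^ 2 + (c * t) ^ 2) := by
    have := congrArg Complex.im hcoe
    rw [UpperHalfPlane.coe_im] at this
    rw [this, Complex.div_im]
    simp [Complex.normSq_apply]
    rw [← sub_div]
    congr 1
    · linear_combination t * hdet
    · rw [he]; ring
  refine ⟨?_, ?_, ?_⟩
  · rw [hre, abs_le, le_div_iff₀ hD, div_le_iff₀ hD]
    have k1 : f * e ≤ 5 * e ^ 2 := by nlinarith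
    have k2 : d * c * t ^ 2 ≤ 5 * (c * t) ^ 2 := by
      have : d * (c * t ^ 2) ≤ 5 * c * (c * t ^ 2) :=
        mul_le_mul_of_nonneg_right r2 (by positivity)
      linarith
    have k3 : 0 ≤ f * e := by positivity
    have k4 : 0 ≤ d * c * t ^ 2 := by positivity
    constructor <;> nlinarith [sq_nonneg e, sq_nonneg (c * t)]
  · rw [him, div_le_div_iff₀ (by positivity) hD]
    have hce : c * e ≤ 5 := by nlinarith
    have k1 : (c * e) ^ 2 ≤ 25 := by nlinarith [mul_nonneg hc.le he0]
    have k2 : (c ^ 2 * t) ^ 2 ≤ 900 ^ 2 := by gcongr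
    have k3 : c ^ 2 * (1 * (e ^ 2 + (c * t) ^ 2)) ≤ c ^ 2 * (t * (900 * (25 + 900 ^ 2))) := by
      nlinarith
    exact le_of_mul_le_mul_left k3 (by positivity)
  · rw [him, div_le_iff₀ hD]
    have : t * 1 ≤ t * (900 * (c ^ 2 * t)) := by
      apply mul_le_mul_of_nonneg_left _ ht.le
      linarith
    nlinarith [sq_nonneg e]

/-- Every point of the vertical ray ending at the limit is moved into the box by the inverse of
some partial product. -/
lemma exists_inv_smul_mem_hBox (hw : IsPositiveProduct w)
    (hp : ∀ n, (w n).1 0 1 ≤ p * (w n).1 1 1 ∧ p * (w n).1 1 0 ≤ (w n).1 0 0)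
    {z : ℍ} (hz : z.re = p) (hz1 : z.im ≤ 1) : ∃ n, (w n)⁻¹ • z ∈ hBox := by
  have ht := z.im_pos
  have hex : ∃ n, 1 < (w (n + 2)).1 1 0 ^ 2 * z.im := by
    obtain ⟨n, hn⟩ := exists_nat_gt (1 / z.im)
    refine ⟨n, ?_⟩
    rw [div_lt_iff₀ ht] at hn
    have h := (hw.entries_nonneg (n + 2)).2.2.1
    push_cast at h
    have hn0 : (0 : ℝ) ≤ n := n.cast_nonneg
    have : (n : ℝ) ≤ (w (n + 2)).1 1 0 ^ 2 := by nlinarith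
    nlinarith
  classical
  have hspec := Nat.find_spec hex
  set n := Nat.find hex with hn
  refine ⟨n + 1, hw.inv_smul_mem_hBox hp (by omega) hz ?_ ?_⟩
  · have h1 := hw.succ_le (n := n + 1) (by omega)
    have h2 : (w (n + 2)).1 1 0 ^ 2 ≤ 900 * (w (n + 1)).1 1 0 ^ 2 := by
      have := (hw.entries_nonneg (n + 2)).2.2.1
      have h0 : (0 : ℝ) ≤ (n + 2 : ℕ) := Nat.cast_nonneg _
      rw [show (900 : ℝ) * (w (n + 1)).1 1 0 ^ 2 = (30 * (w (n + 1)).1 1 0) ^ 2 by ring]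
      exact pow_le_pow_left₀ (h0.trans this) h1 2
    nlinarith
  · rcases Nat.eq_zero_or_pos n with h | h
    · rw [h, zero_add]
      have h1 := hw.one_le_five
      have h2 := (hw.entries_nonneg 1).2.2.1
      push_cast at h2
      nlinarith
    · have := Nat.find_min hex (m := n - 1) (by omega)
      rw [show n - 1 + 2 = n + 1 by omega] at this
      linarith

/-- Every partial product moves a fixed box so that it meets the vertical ray at the limit. -/
lemma smul_hBox_inter_nonempty (hw : IsPositiveProduct w)
    (hp : ∀ n, (w n).1 0 1 ≤ p * (w n).1 1 1 ∧ p * (w n).1 1 0 ≤ (w n).1 0 0)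
    {n : ℕ} (hn : 1 ≤ n) : (w n • hBox ∩ {z : ℍ | z.re = p ∧ z.im ≤ 1}).Nonempty := by
  have h := (hw.entries_nonneg n).2.2.1
  have h1 : (1 : ℝ) ≤ (w n).1 1 0 := le_trans (by exact_mod_cast hn) h
  have h2 : (0 : ℝ) < 1 / (w n).1 1 0 ^ 2 := by positivity
  let z : ℍ := ⟨⟨p, 1 / (w n).1 1 0 ^ 2⟩, h2⟩
  have him : z.im = 1 / (w n).1 1 0 ^ 2 := rfl
  have hprod : (w n).1 1 0 ^ 2 * z.im = 1 := by rw [him]; field_simp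
  refine ⟨z, ?_, rfl, ?_⟩
  · rw [Set.mem_smul_set_iff_inv_smul_mem]
    exact hw.inv_smul_mem_hBox hp hn rfl (by rw [hprod]; norm_num) (by rw [hprod]; norm_num)
  · rw [him, div_le_one (by positivity)]
    nlinarith

end IsPositiveProduct

lemma schottkyReal_of (x : Bool) : (schottkyReal (FreeGroup.of x)).1 =
    bif x then !![5, 2; 2, 1] else !![1, 2; 2, 5] := by
  ext i j
  rw [schottkyReal_apply, schottkyHom, FreeGroup.lift_apply_of]
  cases x <;> fin_cases i <;> fin_cases j <;> simp [schottkyGen]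

lemma isPositiveProduct_blockWord : IsPositiveProduct fun n => schottkyReal (blockWord n) where
  zero := map_one _
  succ n := by
    refine ⟨schottkyReal (FreeGroup.of (decide (Even (Nat.log 2 (n + 1))))), map_mul _ _ _, ?_⟩
    rw [schottkyReal_of]
    intro i j
    cases decide (Even (Nat.log 2 (n + 1))) <;> fin_cases i <;> fin_cases j <;> norm_num

lemma ray_projPt (x : ℝ) : ray (projPt x) = {z : ℍ | z.re = x ∧ z.im ≤ 1} := by
  obtain ⟨a, ha⟩ := Projectivization.exists_smul_eq_mk_rep ℝ ![x, 1] (by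
    intro h
    have := congrFun h 1
    simp at this)
  have h0 : (projPt x).rep 0 = a * x := by
    have := congrFun ha 0
    simpa [projPt, Units.smul_def] using this.symm
  have h1 : (projPt x).rep 1 = a := by
    have := congrFun ha 1
    simpa [projPt, Units.smul_def] using this.symm
  rw [ray, h0, h1, if_neg a.ne_zero, mul_div_cancel_left₀ _ a.ne_zero]

lemma sl2Act_mul (g h : SL(2, ℝ)) (q : RP1) : sl2Act (g * h) q = sl2Act g (sl2Act h q) := by
  induction q using Projectivization.ind with
  | h v hv =>
    simp only [sl2Act, Projectivization.map_mk]
    congr 1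
    simp [Matrix.SpecialLinearGroup.toLin'_apply]

lemma sl2Act_projPt (g : SL(2, ℝ)) {x y : ℝ}
    (h : g.1 0 0 * x + g.1 0 1 = (g.1 1 0 * x + g.1 1 1) * y) :
    sl2Act g (projPt x) = projPt y := by
  simp only [sl2Act, projPt, Projectivization.map_mk]
  rw [Projectivization.mk_eq_mk_iff']
  refine ⟨g.1 1 0 * x + g.1 1 1, ?_⟩
  ext i
  fin_cases i <;>
    simp [Matrix.SpecialLinearGroup.toLin'_apply, Matrix.mulVec, dotProduct, Fin.sum_univ_two, h]

lemma continuous_projPt : Continuous projPt := by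
  have h : Continuous fun x : ℝ => (⟨![x, 1], by
      intro h
      have := congrFun h 1
      simp at this⟩ : { v : Fin 2 → ℝ // v ≠ 0 }) := by
    refine Continuous.subtype_mk ?_ _
    refine continuous_pi fun i => ?_
    fin_cases i
    · exact continuous_id
    · exact continuous_const
  exact continuous_quotient_mk'.comp h

/-- A point on the real line is conical for the image of `H` if infinitely many of the prefixes of
the word `blockWord` lie in a fixed coset of `H`. -/
lemma isConicalLimitPoint_of_blockWord {p : ℝ}
    (hp : ∀ n, (schottkyReal (blockWord n)).1 0 1 ≤ p * (schottkyReal (blockWord n)).1 1 1 ∧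
      p * (schottkyReal (blockWord n)).1 1 0 ≤ (schottkyReal (blockWord n)).1 0 0)
    {H : Subgroup (FreeGroup Bool)} {n : ℕ → ℕ} (hn : Function.Injective n) (hn1 : ∀ m, 1 ≤ n m)
    (u : FreeGroup Bool) (hu : ∀ m, blockWord (n m) * u ∈ H) :
    IsConicalLimitPoint (H.map schottkyReal) (projPt p) := by
  refine ⟨(schottkyReal u)⁻¹ • hBox, isCompact_hBox.image (continuous_const_smul _),
    fun m => schottkyReal (blockWord (n m) * u), ?_, fun m => ⟨_, hu m, rfl⟩, fun m => ?_⟩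
  · intro m m' h
    exact hn (blockWord_injective (mul_right_cancel (schottkyReal_injective h)))
  · simp only [ray_projPt, map_mul, mul_smul, smul_inv_smul]
    exact isPositiveProduct_blockWord.smul_hBox_inter_nonempty hp (hn1 m)

lemma not_isConicalLimitPoint_of_weight {p : ℝ}
    (hp : ∀ n, (schottkyReal (blockWord n)).1 0 1 ≤ p * (schottkyReal (blockWord n)).1 1 1 ∧
      p * (schottkyReal (blockWord n)).1 1 0 ≤ (schottkyReal (blockWord n)).1 0 0)
    {H : Subgroup SL(2, ℝ)} (hH : ∀ g ∈ H, ∃ v, weight 1 1 v = 1 ∧ schottkyReal v = g) :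
    ¬ IsConicalLimitPoint H (projPt p) := by
  rintro ⟨K, hK, γ, hγ, hmem, hmeet⟩
  choose v hv hvγ using fun k => hH _ (hmem k)
  have key (k : ℕ) : ∃ n : ℕ,
      (((schottkyReal ((blockWord n)⁻¹ * v k)) • K) ∩ hBox).Nonempty := by
    obtain ⟨z, hzK, hz⟩ := hmeet k
    rw [ray_projPt] at hz
    obtain ⟨n, hn⟩ := isPositiveProduct_blockWord.exists_inv_smul_mem_hBox hp hz.1 hz.2
    refine ⟨n, _, ?_, hn⟩
    rw [map_mul, map_inv, mul_smul, hvγ]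
    exact Set.smul_mem_smul_set hzK
  choose n hn using key
  have hfin : Set.Finite {g : schottkyReal.range | ((g • ·) '' K ∩ hBox).Nonempty} :=
    (@UpperHalfPlane.instProperlyDiscontinuousSL2RSubgroup schottkyReal.range
      discreteTopology_schottky).finite_disjoint_inter_image hK isCompact_hBox
  refine Set.infinite_of_injective_forall_mem (f := fun k =>
    (⟨schottkyReal ((blockWord (n k))⁻¹ * v k), _, rfl⟩ : schottkyReal.range)) ?_ hn hfin
  intro k l h
  have h' := schottkyReal_injective (congrArg Subtype.val h)
  have hw := congrArg (weight 1 1) h'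
  rw [map_mul, map_mul, map_inv, map_inv, hv, hv, weight_one_one_blockWord,
    weight_one_one_blockWord] at hw
  have hkl : n k = n l := by simpa using hw
  rw [hkl] at h'
  apply hγ
  rw [← hvγ, ← hvγ, mul_left_cancel h']

/-- The commutator of the two free generators. -/
def genCommutator : FreeGroup Bool :=
  FreeGroup.of true * FreeGroup.of false * (FreeGroup.of true)⁻¹ * (FreeGroup.of false)⁻¹

lemma schottkyReal_commutator :
    (schottkyReal genCommutator).1 = !![-319, 144; -144, 65] := by
  simp only [genCommutator, map_mul, map_inv, Matrix.SpecialLinearGroup.coe_mul,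
    Matrix.SpecialLinearGroup.coe_inv]
  rw [schottkyReal_of, schottkyReal_of]
  ext i j
  fin_cases i <;> fin_cases j <;>
    norm_num [Matrix.adjugate_fin_two, Matrix.mul_apply, Fin.sum_univ_two]

lemma commutator_of_ne_one : genCommutator ≠ 1 := by
  intro h
  have := schottkyReal_commutator
  rw [h, map_one] at this
  have := congrFun (congrFun this 0) 0
  norm_num at this

lemma exists_fixed_commutator : ∃ ξ : ℝ, 0 < ξ ∧
    sl2Act (schottkyReal genCommutator) (projPt ξ) = projPt ξ := by
  have h7 : √(7 : ℝ) ^ 2 = 7 := Real.sq_sqrt (by norm_num)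
  refine ⟨(4 + √7) / 3, by positivity, sl2Act_projPt _ ?_⟩
  rw [schottkyReal_commutator]
  norm_num
  linarith

open Filter Topology in
lemma projPt_mem_limitSet {p : ℝ}
    (hp : ∀ n, (schottkyReal (blockWord n)).1 0 1 ≤ p * (schottkyReal (blockWord n)).1 1 1 ∧
      p * (schottkyReal (blockWord n)).1 1 0 ≤ (schottkyReal (blockWord n)).1 0 0)
    {H : Subgroup SL(2, ℝ)} (hH : ∀ u, schottkyReal
      (u * genCommutator * u⁻¹) ∈ H) : projPt p ∈ limitSet H := by
  obtain ⟨ξ, hξ, hfix⟩ := exists_fixed_commutator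
  let a (n : ℕ) := (schottkyReal (blockWord n)).1 0 0
  let b (n : ℕ) := (schottkyReal (blockWord n)).1 0 1
  let c (n : ℕ) := (schottkyReal (blockWord n)).1 1 0
  let d (n : ℕ) := (schottkyReal (blockWord n)).1 1 1
  have hcn (n : ℕ) : (n : ℝ) ≤ c n := (isPositiveProduct_blockWord.entries_nonneg n).2.2.1
  have hc (n : ℕ) : 0 ≤ c n := n.cast_nonneg.trans (hcn n)
  have hd (n : ℕ) : 1 ≤ d n := (isPositiveProduct_blockWord.entries_nonneg n).2.2.2
  have hden (n : ℕ) : 0 < c n * ξ + d n := by nlinarith [hd n, mul_nonneg (hc n) hξ.le]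
  have hdet (n : ℕ) : a n * d n - b n * c n = 1 :=
    IsPositiveProduct.det_eq (w := fun n => schottkyReal (blockWord n)) n
  let x (n : ℕ) := (a n * ξ + b n) / (c n * ξ + d n)
  have hx (n : ℕ) : sl2Act (schottkyReal (blockWord n)) (projPt ξ) = projPt (x n) :=
    sl2Act_projPt _ (mul_div_cancel₀ _ (hden n).ne').symm
  have hlim : Tendsto x atTop (𝓝 p) := by
    rw [tendsto_iff_dist_tendsto_zero]
    refine squeeze_zero' (Eventually.of_forall fun _ => dist_nonneg) ?_
      tendsto_one_div_atTop_nhds_zero_nat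
    filter_upwards [eventually_ge_atTop 1] with n hn
    have hn1 : (1 : ℝ) ≤ n := by exact_mod_cast hn
    have hcp : 0 < c n := by linarith [hcn n]
    have hdp : 0 < d n := by linarith [hd n]
    have h1 : b n / d n ≤ x n := by
      rw [div_le_div_iff₀ hdp (hden n)]
      nlinarith [hdet n]
    have h2 : x n ≤ a n / c n := by
      rw [div_le_div_iff₀ (hden n) hcp]
      nlinarith [hdet n]
    have h3 : b n / d n ≤ p := (div_le_iff₀ hdp).2 (hp n).1
    have h4 : p ≤ a n / c n := (le_div_iff₀ hcp).2 (hp n).2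
    have h5 : a n / c n - b n / d n = 1 / (c n * d n) := by
      rw [div_sub_div _ _ hcp.ne' hdp.ne']
      congr 1
      linarith [hdet n]
    have h6 : 1 / (c n * d n) ≤ 1 / n :=
      one_div_le_one_div_of_le (by linarith) (by nlinarith [hcn n, hd n])
    rw [Real.dist_eq, abs_le]
    constructor <;> linarith
  refine mem_closure_of_tendsto (continuous_projPt.continuousAt.tendsto.comp hlim)
    (Eventually.of_forall fun n => ⟨_, hH (blockWord n), isHyperbolic_schottkyReal ?_, ?_⟩)
  · rw [Ne, conj_eq_one_iff]
    exact commutator_of_ne_one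
  · rw [Function.comp_apply, map_mul, sl2Act_mul, ← hx, ← sl2Act_mul (schottkyReal (blockWord n)⁻¹),
      ← map_mul, inv_mul_cancel, map_mul, sl2Act_mul, map_one]
    have h1 : sl2Act 1 (projPt ξ) = projPt ξ := sl2Act_projPt _ (by simp)
    rw [h1, hfix]

/-- **Proposition 3.3.** There exist a non-elementary discrete purely hyperbolic subgroup `Γ`
of `SL(2, ℝ)`, nontrivial subgroups `Φ` and `Θ` of `Γ`, and a point `p ∈ ℝP¹` that is a
conical limit point of both `Φ` and `Θ` and lies in `Λ(Φ ∩ Θ)`, but is not a conical limit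
point of `Φ ∩ Θ`. -/
theorem exists_limit_in_limitSet_inter_not_conical :
    ∃ Γ Φ Θ : Subgroup SL(2, ℝ), DiscreteTopology Γ ∧ PurelyHyperbolic Γ ∧
      IsNonElementary Γ ∧ Φ ≤ Γ ∧ Θ ≤ Γ ∧ Φ ≠ ⊥ ∧ Θ ≠ ⊥ ∧
      ∃ p : RP1, IsConicalLimitPoint Φ p ∧ IsConicalLimitPoint Θ p ∧
        p ∈ limitSet (Φ ⊓ Θ) ∧ ¬ IsConicalLimitPoint (Φ ⊓ Θ) p := by
  obtain ⟨p, hp⟩ := isPositiveProduct_blockWord.exists_limit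
  have hker (a b : ℤ) (u : FreeGroup Bool) :
      u * genCommutator * u⁻¹ ∈ (weight a b).ker := by
    simp [MonoidHom.mem_ker, genCommutator, mul_comm]
  have hbot (a b : ℤ) : (weight a b).ker.map schottkyReal ≠ ⊥ := by
    intro h
    rw [Subgroup.map_eq_bot_iff_of_injective _ schottkyReal_injective] at h
    have := hker a b 1
    rw [h, Subgroup.mem_bot, conj_eq_one_iff] at this
    exact commutator_of_ne_one this
  have hpow : Function.Injective fun m : ℕ => 2 ^ m - 1 := by
    intro m l h
    have h1 := Nat.one_le_two_pow (n := m)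
    have h2 := Nat.one_le_two_pow (n := l)
    exact Nat.pow_right_injective le_rfl (show 2 ^ m = 2 ^ l by simp only at h; omega)
  have hpos (m : ℕ) : 1 ≤ 2 ^ (m + 1) - 1 := by
    have := Nat.one_le_two_pow (n := m)
    rw [pow_succ]; omega
  refine ⟨schottkyReal.range, (weight 1 (-2)).ker.map schottkyReal,
    (weight (-2) 1).ker.map schottkyReal, discreteTopology_schottky, purelyHyperbolic_schottky,
    isNonElementary_schottky, Subgroup.map_le_range _ _, Subgroup.map_le_range _ _, hbot _ _,
    hbot _ _, projPt p, ?_, ?_, ?_, ?_⟩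
  · refine isConicalLimitPoint_of_blockWord hp (n := fun m => 2 ^ (2 * m + 1) - 1)
      (hpow.comp fun m l h => by simpa using h) (fun m => hpos _) (FreeGroup.of true)⁻¹ fun m => ?_
    rw [MonoidHom.mem_ker, map_mul, weight_blockWord_odd, map_inv, weight_of]
    simp
  · refine isConicalLimitPoint_of_blockWord hp (n := fun m => 2 ^ (2 * (m + 1)) - 1)
      (hpow.comp fun m l h => by simpa using h) (fun m => hpos _) 1 fun m => ?_
    rw [MonoidHom.mem_ker, mul_one, weight_blockWord_even]
  · exact projPt_mem_limitSet hp fun u => ⟨⟨_, hker _ _ u, rfl⟩, ⟨_, hker _ _ u, rfl⟩⟩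
  · refine not_isConicalLimitPoint_of_weight hp ?_
    rintro _ ⟨⟨v, hv, rfl⟩, ⟨v', hv', h⟩⟩
    obtain rfl := schottkyReal_injective h
    refine ⟨v', ?_, rfl⟩
    rw [weight_one_one, MonoidHom.mem_ker.1 hv, MonoidHom.mem_ker.1 hv', one_mul, inv_one]

end
end
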